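/- arXiv:2507.09526 — 2 statements merged into one kernel-verified Lean document; each statement's English description precedes it below -/
import Mathlib

section
/- Let (V, V₊, v) and (W, W₊, w) be complete order unit spaces with open cones C := V₊° and D := W₊°, and let Φ: C → D be a gauge-reversing bijection with Φ(v) = w; let DΦ(x) denote the Fréchet derivative of Φ at x ∈ C. Let λ > 0. Then for all x, y ∈ C with x ≥ λ⁻¹v and y ≥ λ⁻¹v one has: (1) ‖(DΦ(x) − DΦ(y))(u)‖_w ≤ 6λ³‖x − y‖_v‖u‖_v for every u ∈ V₊; and (2) ‖DΦ(x) − DΦ(y)‖ ≤ 18λ³‖x − y‖_v, where ‖·‖ denotes the operator norm from (V, ‖·‖_v) to (W, ‖·‖_w). -/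
open scoped Topology

section Defs

/-- `(V, P, v)` is an order unit space: `P` is a proper cone, the induced order is
archimedean, `v` is an order unit, and the norm of `V` is the order unit norm. -/
structure IsOrderUnitSpace (V : Type*) [NormedAddCommGroup V] [NormedSpace ℝ V]
    (P : Set V) (v : V) : Prop where
  add_mem : ∀ x ∈ P, ∀ y ∈ P, x + y ∈ P
  smul_mem : ∀ r : ℝ, 0 ≤ r → ∀ x ∈ P, r • x ∈ P
  proper : ∀ x : V, x ∈ P → -x ∈ P → x = 0
  archimedean : ∀ x b : V, (∀ r : ℝ, 0 ≤ r → b - r • x ∈ P) → -x ∈ P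
  unit_mem : v ∈ P
  unit_order : ∀ x : V, ∃ r : ℝ, 0 < r ∧ r • v - x ∈ P
  norm_eq : ∀ x : V, ‖x‖ = sInf {r : ℝ | 0 ≤ r ∧ x + r • v ∈ P ∧ r • v - x ∈ P}

variable {V : Type*} [NormedAddCommGroup V] [NormedSpace ℝ V]
variable {W : Type*} [NormedAddCommGroup W] [NormedSpace ℝ W]

/-- The open cone (norm interior of the cone `P`) of an order unit space. -/
def openCone (P : Set V) (v : V) : Set V := {x | ∃ ε : ℝ, 0 < ε ∧ x - ε • v ∈ P}

/-- The order unit norm `‖x‖_u` determined by an order unit `u`. -/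
noncomputable def ounorm (P : Set V) (u x : V) : ℝ :=
  sInf {r : ℝ | 0 ≤ r ∧ x + r • u ∈ P ∧ r • u - x ∈ P}

/-- Thompson's metric `d_T(x,y) = log inf {r ≥ 1 : r⁻¹ y ≤ x ≤ r y}`. -/
noncomputable def thompsonDist (P : Set V) (x y : V) : ℝ :=
  Real.log (sInf {r : ℝ | 1 ≤ r ∧ x - r⁻¹ • y ∈ P ∧ r • y - x ∈ P})

/-- `Φ` is a gauge-reversing bijection from the open cone of `(V, P, v)` onto the
open cone of `(W, Q, w)`: a bijection, homogeneous of degree `-1`,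
and an order-anti-isomorphism. -/
def GaugeReversing (P : Set V) (v : V) (Q : Set W) (w : W) (Φ : V → W) : Prop :=
  Set.BijOn Φ (openCone P v) (openCone Q w) ∧
  (∀ x ∈ openCone P v, ∀ r : ℝ, 0 < r → Φ (r • x) = r⁻¹ • Φ x) ∧
  (∀ x ∈ openCone P v, ∀ y ∈ openCone P v, (y - x ∈ P ↔ Φ x - Φ y ∈ Q))

/-- `Φ` is a gauge-preserving bijection from the open cone of `(V, P, v)` onto the
open cone of `(W, Q, w)`: a bijection, homogeneous of degree `1`,
and an order-isomorphism. -/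
def GaugePreserving (P : Set V) (v : V) (Q : Set W) (w : W) (Φ : V → W) : Prop :=
  Set.BijOn Φ (openCone P v) (openCone Q w) ∧
  (∀ x ∈ openCone P v, ∀ r : ℝ, 0 < r → Φ (r • x) = r • Φ x) ∧
  (∀ x ∈ openCone P v, ∀ y ∈ openCone P v, (y - x ∈ P ↔ Φ y - Φ x ∈ Q))

/-- `mul` is a JB-algebra structure on the order unit space `(V, P, v)` with unit
element `v` and cone of squares `P`. -/
def IsJBAlgebraStructure (P : Set V) (v : V) (mul : V →ₗ[ℝ] V →ₗ[ℝ] V) : Prop :=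
  (∀ x y : V, mul x y = mul y x) ∧
  (∀ x : V, mul v x = x) ∧
  (∀ x y : V, mul x (mul y (mul x x)) = mul (mul x y) (mul x x)) ∧
  (∀ x y : V, ‖mul x y‖ ≤ ‖x‖ * ‖y‖) ∧
  (∀ x : V, ‖mul x x‖ = ‖x‖ ^ 2) ∧
  (∀ x y : V, ‖mul x x‖ ≤ ‖mul x x + mul y y‖) ∧
  P = {y : V | ∃ x : V, mul x x = y}

/-- `S` is a `d_T`-symmetry of the open cone of `(V, P, v)` at the point `p`:
an involutive `d_T`-isometry of the open cone having `p` as an isolated fixed point. -/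
def IsDTSymmetry (P : Set V) (v : V) (S : V → V) (p : V) : Prop :=
  (∀ x ∈ openCone P v, S x ∈ openCone P v) ∧
  (∀ x ∈ openCone P v, S (S x) = x) ∧
  (∀ x ∈ openCone P v, ∀ y ∈ openCone P v,
    thompsonDist P (S x) (S y) = thompsonDist P x y) ∧
  p ∈ openCone P v ∧ S p = p ∧
  (∃ ε : ℝ, 0 < ε ∧ ∀ x ∈ openCone P v, S x = x → thompsonDist P p x < ε → x = p)

/-- A complete order unit space `(W, Q, w)` together with a gauge-reversing bijection
from the open cone of `(V, P, v)` onto the open cone of `(W, Q, w)`. -/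
structure GaugeReversingTarget (V : Type*) [NormedAddCommGroup V] [NormedSpace ℝ V]
    (P : Set V) (v : V) where
  W : Type
  [instGroup : NormedAddCommGroup W]
  [instSpace : NormedSpace ℝ W]
  [instComplete : CompleteSpace W]
  Q : Set W
  w : W
  ous : IsOrderUnitSpace W Q w
  Φ : V → W
  grev : GaugeReversing P v Q w Φ

/-- The state space of the order unit space `(V, P, v)`, as a subset of the
weak-* dual of `V`. -/
def stateSpace (P : Set V) (v : V) : Set (WeakDual ℝ V) :=
  {ρ | (∀ x ∈ P, 0 ≤ ρ x) ∧ ρ v = 1}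

/-- A real-valued function on the dual is affine on `K`. -/
def AffineOnK (K : Set (WeakDual ℝ V)) (g : WeakDual ℝ V → ℝ) : Prop :=
  ∀ ρ ∈ K, ∀ σ ∈ K, ∀ t : ℝ, 0 ≤ t → t ≤ 1 →
    g ((1 - t) • ρ + t • σ) = (1 - t) * g ρ + t * g σ

/-- An extended-real-valued function on the dual is affine on `K`. -/
def AffineOnKE (K : Set (WeakDual ℝ V)) (g : WeakDual ℝ V → EReal) : Prop :=
  ∀ ρ ∈ K, ∀ σ ∈ K, ∀ t : ℝ, 0 ≤ t → t ≤ 1 →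
    g ((1 - t) • ρ + t • σ) = ((1 - t : ℝ) : EReal) * g ρ + ((t : ℝ) : EReal) * g σ

/-- Membership in the extended cone `C_usc` of nonnegative affine upper semicontinuous
functions on the state space `K`. -/
def memCusc (K : Set (WeakDual ℝ V)) (g : WeakDual ℝ V → ℝ) : Prop :=
  (∀ ρ ∈ K, 0 ≤ g ρ) ∧ AffineOnK K g ∧ UpperSemicontinuousOn g K

/-- `p` is an extremal vector of the cone `C_usc` over the state space `K`. -/
def IsExtremalCusc (K : Set (WeakDual ℝ V)) (p : WeakDual ℝ V → ℝ) : Prop :=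
  memCusc K p ∧ (∃ ρ ∈ K, p ρ ≠ 0) ∧
  ∀ x, memCusc K x → (∀ ρ ∈ K, x ρ ≤ p ρ) →
    ∃ t : ℝ, 0 ≤ t ∧ t ≤ 1 ∧ ∀ ρ ∈ K, x ρ = t * p ρ

/-- The cone `C_usc` over the state space `K` is strongly atomic: each of its
members is the least upper bound of the extremal vectors it dominates. -/
def StronglyAtomicCusc (K : Set (WeakDual ℝ V)) : Prop :=
  ∀ g, memCusc K g →
    (∀ p, IsExtremalCusc K p → (∀ ρ ∈ K, p ρ ≤ g ρ) → ∀ ρ ∈ K, p ρ ≤ g ρ) ∧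
    (∀ h, memCusc K h →
      (∀ p, IsExtremalCusc K p → (∀ ρ ∈ K, p ρ ≤ g ρ) → ∀ ρ ∈ K, p ρ ≤ h ρ) →
      ∀ ρ ∈ K, g ρ ≤ h ρ)

end Defs

namespace IsOrderUnitSpace

variable {V : Type*} [NormedAddCommGroup V] [NormedSpace ℝ V] {P : Set V} {v : V}

theorem zero_mem (hV : IsOrderUnitSpace V P v) : (0 : V) ∈ P := by
  simpa using hV.smul_mem 0 le_rfl v hV.unit_mem

theorem smul_mem_iff (hV : IsOrderUnitSpace V P v) {r : ℝ} (hr : 0 < r) {x : V} :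
    r • x ∈ P ↔ x ∈ P := by
  refine ⟨fun h => ?_, hV.smul_mem r hr.le x⟩
  simpa [smul_smul, hr.ne'] using hV.smul_mem r⁻¹ (inv_nonneg.2 hr.le) _ h

theorem mem_of_forall_add_smul_mem (hV : IsOrderUnitSpace V P v) {x : V}
    (h : ∀ ε : ℝ, 0 < ε → x + ε • v ∈ P) : x ∈ P := by
  have := hV.archimedean (-x) v fun r hr => by
    rcases hr.eq_or_lt with rfl | hr
    · simpa using hV.unit_mem
    · have h1 := hV.smul_mem r hr.le _ (h r⁻¹ (inv_pos.2 hr))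
      rw [smul_add, smul_smul, mul_inv_cancel₀ hr.ne'] at h1
      convert h1 using 1
      module
  simpa using this

theorem norm_smul_add_mem_and_sub_mem (hV : IsOrderUnitSpace V P v) (x : V) :
    ‖x‖ • v + x ∈ P ∧ ‖x‖ • v - x ∈ P := by
  have hne : {r : ℝ | 0 ≤ r ∧ x + r • v ∈ P ∧ r • v - x ∈ P}.Nonempty := by
    obtain ⟨r, hr, h1⟩ := hV.unit_order x
    obtain ⟨s, hs, h2⟩ := hV.unit_order (-x)
    refine ⟨r + s, by positivity, ?_, ?_⟩
    · convert hV.add_mem _ h2 _ (hV.smul_mem r hr.le v hV.unit_mem) using 1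
      module
    · convert hV.add_mem _ h1 _ (hV.smul_mem s hs.le v hV.unit_mem) using 1
      module
  have key : ∀ ε : ℝ, 0 < ε →
      ‖x‖ • v + x + ε • v ∈ P ∧ ‖x‖ • v - x + ε • v ∈ P := by
    intro ε hε
    obtain ⟨r, ⟨-, h1, h2⟩, hlt⟩ := exists_lt_of_csInf_lt hne
      (show sInf _ < ‖x‖ + ε by rw [← hV.norm_eq x]; linarith)
    have h3 := hV.smul_mem (‖x‖ + ε - r) (by linarith) v hV.unit_mem
    constructor
    · convert hV.add_mem _ h1 _ h3 using 1
      module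
    · convert hV.add_mem _ h2 _ h3 using 1
      module
  exact ⟨hV.mem_of_forall_add_smul_mem fun ε hε => (key ε hε).1,
    hV.mem_of_forall_add_smul_mem fun ε hε => (key ε hε).2⟩

theorem norm_le (hV : IsOrderUnitSpace V P v) {x : V} {r : ℝ} (hr : 0 ≤ r)
    (h1 : r • v + x ∈ P) (h2 : r • v - x ∈ P) : ‖x‖ ≤ r := by
  rw [hV.norm_eq x]
  exact csInf_le ⟨0, fun s hs => hs.1⟩ ⟨hr, by rwa [add_comm], h2⟩

theorem norm_unit_le (hV : IsOrderUnitSpace V P v) : ‖v‖ ≤ 1 :=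
  hV.norm_le zero_le_one (by simpa using hV.add_mem _ hV.unit_mem _ hV.unit_mem)
    (by simpa using hV.zero_mem)

theorem isClosed (hV : IsOrderUnitSpace V P v) : IsClosed P := by
  rw [← closure_subset_iff_isClosed]
  intro x hx
  refine hV.mem_of_forall_add_smul_mem fun ε hε => ?_
  obtain ⟨y, hy, hxy⟩ := Metric.mem_closure_iff.1 hx ε hε
  rw [dist_eq_norm] at hxy
  have h1 := (hV.norm_smul_add_mem_and_sub_mem (x - y)).1
  have h2 := hV.smul_mem (ε - ‖x - y‖) (by linarith) v hV.unit_mem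
  convert hV.add_mem _ hy _ (hV.add_mem _ h1 _ h2) using 1
  module

theorem convex (hV : IsOrderUnitSpace V P v) : Convex ℝ P := by
  intro x hx y hy a b ha hb _
  exact hV.add_mem _ (hV.smul_mem a ha x hx) _ (hV.smul_mem b hb y hy)

theorem unit_mem_openCone (hV : IsOrderUnitSpace V P v) : v ∈ openCone P v :=
  ⟨1, one_pos, by simpa using hV.zero_mem⟩

theorem openCone_subset (hV : IsOrderUnitSpace V P v) {x : V} (hx : x ∈ openCone P v) :
    x ∈ P := by
  obtain ⟨ε, hε, h⟩ := hx
  convert hV.add_mem _ h _ (hV.smul_mem ε hε.le v hV.unit_mem) using 1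
  module

theorem mem_openCone_of_sub_mem (hV : IsOrderUnitSpace V P v) {x y : V}
    (hx : x ∈ openCone P v) (hxy : y - x ∈ P) : y ∈ openCone P v := by
  obtain ⟨ε, hε, h⟩ := hx
  refine ⟨ε, hε, ?_⟩
  convert hV.add_mem _ h _ hxy using 1
  module

theorem add_mem_openCone (hV : IsOrderUnitSpace V P v) {x y : V}
    (hx : x ∈ openCone P v) (hy : y ∈ P) : x + y ∈ openCone P v :=
  hV.mem_openCone_of_sub_mem hx (by simpa using hy)

theorem smul_mem_openCone (hV : IsOrderUnitSpace V P v) {x : V} {r : ℝ}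
    (hr : 0 < r) (hx : x ∈ openCone P v) : r • x ∈ openCone P v := by
  obtain ⟨ε, hε, h⟩ := hx
  refine ⟨r * ε, by positivity, ?_⟩
  convert hV.smul_mem r hr.le _ h using 1
  module

theorem exists_sub_smul_mem (hV : IsOrderUnitSpace V P v) {x : V} (hx : x ∈ openCone P v)
    (y : V) : ∃ r : ℝ, 0 < r ∧ x - r • y ∈ P := by
  obtain ⟨ε, hε, h⟩ := hx
  obtain ⟨s, hs, h'⟩ := hV.unit_order y
  refine ⟨ε / s, by positivity, ?_⟩
  convert hV.add_mem _ h _ (hV.smul_mem (ε / s) (by positivity) _ h') using 1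
  rw [smul_sub, smul_smul, div_mul_cancel₀ _ hs.ne']
  abel

end IsOrderUnitSpace

/-- A pure state of `(V, P, v)`: a positive functional with value `1` at `v` that
dominates no positive functionals but its own multiples. -/
def IsPureState {V : Type*} [NormedAddCommGroup V] [NormedSpace ℝ V] (P : Set V) (v : V)
    (σ : V →ₗ[ℝ] ℝ) : Prop :=
  (∀ p ∈ P, 0 ≤ σ p) ∧ σ v = 1 ∧
  ∀ φ : V →ₗ[ℝ] ℝ, (∀ p ∈ P, 0 ≤ φ p) → (∀ p ∈ P, φ p ≤ σ p) → ∃ t : ℝ, φ = t • σ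

section PureStates

variable {V : Type*} [NormedAddCommGroup V] [NormedSpace ℝ V] {P : Set V} {v : V}

theorem IsPureState.le {σ : V →ₗ[ℝ] ℝ} (hσ : IsPureState P v σ) {x y : V}
    (h : y - x ∈ P) : σ x ≤ σ y := by
  have := hσ.1 _ h
  rw [map_sub] at this
  linarith

theorem IsPureState.pos {σ : V →ₗ[ℝ] ℝ} (hσ : IsPureState P v σ) {x : V}
    (hx : x ∈ openCone P v) : 0 < σ x := by
  obtain ⟨ε, hε, h⟩ := hx
  have := hσ.le h
  rw [map_smul, hσ.2.1, smul_eq_mul, mul_one] at this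
  linarith

/-- If the pure state `σ` vanishes at `y`, it is arbitrarily small at some `c ∈ P` above `y`. -/
theorem IsPureState.exists_upper_bound (hV : IsOrderUnitSpace V P v) {σ : V →ₗ[ℝ] ℝ}
    (hσ : IsPureState P v σ) {y : V} (hy : σ y = 0) {η : ℝ} (hη : 0 < η) :
    ∃ c ∈ P, c - y ∈ P ∧ σ c < η := by
  by_contra! hcon
  let S : V → Set ℝ := fun z => {r | ∃ c ∈ P, c - z ∈ P ∧ σ c = r}
  let q : V → ℝ := fun z => sInf (S z)
  have hne : ∀ z, (S z).Nonempty := by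
    intro z
    obtain ⟨r, hr, h⟩ := hV.unit_order z
    exact ⟨_, r • v, hV.smul_mem r hr.le v hV.unit_mem, h, rfl⟩
  have hbdd : ∀ z, BddBelow (S z) := by
    intro z
    refine ⟨0, ?_⟩
    rintro _ ⟨c, hc, -, rfl⟩
    exact hσ.1 c hc
  have hq_le : ∀ z c, c ∈ P → c - z ∈ P → q z ≤ σ c := fun z c hc hcz =>
    csInf_le (hbdd z) ⟨c, hc, hcz, rfl⟩
  have hle_q : ∀ z r, (∀ c ∈ P, c - z ∈ P → r ≤ σ c) → r ≤ q z := by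
    intro z r h
    refine le_csInf (hne z) ?_
    rintro _ ⟨c, hc, hcz, rfl⟩
    exact h c hc hcz
  have hq_nonneg : ∀ z, 0 ≤ q z := fun z => hle_q z 0 fun c hc _ => hσ.1 c hc
  have hq_nonpos : ∀ z, -z ∈ P → q z ≤ 0 := fun z hz => by
    simpa using hq_le z 0 hV.zero_mem (by simpa using hz)
  have hq_smul_le : ∀ c : ℝ, 0 < c → ∀ z, q (c • z) ≤ c * q z := by
    intro c hc z
    rw [← div_le_iff₀' hc]
    refine hle_q _ _ fun d hd hdz => ?_
    rw [div_le_iff₀' hc, ← smul_eq_mul, ← map_smul]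
    refine hq_le _ _ (hV.smul_mem c hc.le d hd) ?_
    rw [← smul_sub]
    exact hV.smul_mem c hc.le _ hdz
  have hq_smul : ∀ c : ℝ, 0 < c → ∀ z, q (c • z) = c * q z := by
    intro c hc z
    refine le_antisymm (hq_smul_le c hc z) ?_
    have := hq_smul_le c⁻¹ (inv_pos.2 hc) (c • z)
    rw [smul_smul, inv_mul_cancel₀ hc.ne', one_smul] at this
    rwa [le_inv_mul_iff₀ hc] at this
  have hq_add : ∀ z z', q (z + z') ≤ q z + q z' := by
    intro z z'
    rw [← sub_le_iff_le_add]
    refine hle_q _ _ fun c hc hcz => ?_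
    rw [sub_le_comm]
    refine hle_q _ _ fun c' hc' hcz' => ?_
    rw [sub_le_iff_le_add, ← map_add]
    refine hq_le _ _ (hV.add_mem _ hc' _ hc) ?_
    convert hV.add_mem _ hcz' _ hcz using 1
    abel
  have hqy : η ≤ q y := hle_q y η hcon
  have hy0 : y ≠ 0 := by
    rintro rfl
    have := hq_nonpos 0 (by simpa using hV.zero_mem)
    linarith
  obtain ⟨φ, hφ1, hφ2⟩ := exists_extension_of_le_sublinear
    (LinearPMap.mkSpanSingleton (K := ℝ) y (q y) hy0) q hq_smul hq_add (by
      rintro ⟨z, hz⟩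
      obtain ⟨t, rfl⟩ := Submodule.mem_span_singleton.1 hz
      rw [LinearPMap.mkSpanSingleton'_apply]
      change t • q y ≤ q (t • y)
      rw [smul_eq_mul]
      rcases lt_or_ge 0 t with ht | ht
      · exact (hq_smul t ht y).ge
      · exact (mul_nonpos_of_nonpos_of_nonneg ht (hq_nonneg y)).trans (hq_nonneg _))
  have hφy : φ y = q y := by
    have := hφ1 ⟨y, Submodule.mem_span_singleton_self y⟩
    rwa [LinearPMap.mkSpanSingleton_apply] at this
  obtain ⟨t, rfl⟩ := hσ.2.2 φ
    (fun p hp => by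
      have := (hφ2 (-p)).trans (hq_nonpos (-p) (by simpa using hp))
      rw [map_neg] at this
      linarith)
    (fun p hp => (hφ2 p).trans (hq_le p p hp (by simpa using hV.zero_mem)))
  rw [LinearMap.smul_apply, hy, smul_zero] at hφy
  linarith

theorem IsOrderUnitSpace.abs_le_of_positive (hV : IsOrderUnitSpace V P v) {φ : V →ₗ[ℝ] ℝ}
    (hφ : ∀ p ∈ P, 0 ≤ φ p) (y : V) : |φ y| ≤ φ v * ‖y‖ := by
  have h1 := hφ _ (hV.norm_smul_add_mem_and_sub_mem y).1
  have h2 := hφ _ (hV.norm_smul_add_mem_and_sub_mem y).2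
  rw [map_add, map_smul, smul_eq_mul] at h1
  rw [map_sub, map_smul, smul_eq_mul] at h2
  rw [abs_le]
  constructor <;> linarith

theorem IsOrderUnitSpace.isCompact_stateSpace (hV : IsOrderUnitSpace V P v) :
    IsCompact (stateSpace P v) := by
  refine (WeakDual.isCompact_polar ℝ (Metric.closedBall_mem_nhds (0 : V) one_pos)).of_isClosed_subset
    ?_ ?_
  · have : stateSpace P v = (⋂ x ∈ P, {ρ : WeakDual ℝ V | 0 ≤ ρ x}) ∩ {ρ | ρ v = 1} := by
      ext ρ
      simp [stateSpace]
    rw [this]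
    refine IsClosed.inter (isClosed_biInter fun x _ => ?_) ?_
    · exact isClosed_le continuous_const (WeakDual.eval_continuous x)
    · exact isClosed_eq (WeakDual.eval_continuous v) continuous_const
  · rintro ρ ⟨hρ, hρv⟩
    rw [WeakDual.polar_def]
    intro x hx
    have h := hV.abs_le_of_positive (φ := (ρ : V →L[ℝ] ℝ).toLinearMap) hρ x
    change |ρ x| ≤ ρ v * ‖x‖ at h
    rw [mem_closedBall_zero_iff] at hx
    rw [hρv, one_mul] at h
    exact h.trans hx

theorem IsOrderUnitSpace.exists_mem_stateSpace_neg (hV : IsOrderUnitSpace V P v) {z : V}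
    (hz : z ∉ P) : ∃ ρ ∈ stateSpace P v, ρ z < 0 := by
  obtain ⟨f, a, hfa, hf⟩ := geometric_hahn_banach_point_closed hV.convex hV.isClosed hz
  have ha : a < 0 := by simpa using hf 0 hV.zero_mem
  have hpos : ∀ p ∈ P, 0 ≤ f p := by
    intro p hp
    by_contra! hneg
    have h := hf _ (hV.smul_mem (a / f p) (div_nonneg_of_nonpos ha.le hneg.le) p hp)
    rw [map_smul, smul_eq_mul, div_mul_cancel₀ _ hneg.ne] at h
    exact lt_irrefl a h
  have hfv : 0 < f v := by
    have h := hV.abs_le_of_positive (φ := f.toLinearMap) hpos z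
    change |f z| ≤ f v * ‖z‖ at h
    have h0 : 0 < |f z| := abs_pos.2 (by linarith)
    exact pos_of_mul_pos_left (h0.trans_le h) (norm_nonneg z)
  refine ⟨StrongDual.toWeakDual ((f v)⁻¹ • f), ⟨fun p hp => ?_, ?_⟩, ?_⟩
  · change 0 ≤ (f v)⁻¹ * f p
    exact mul_nonneg (inv_nonneg.2 hfv.le) (hpos p hp)
  · change (f v)⁻¹ * f v = 1
    exact inv_mul_cancel₀ hfv.ne'
  · change (f v)⁻¹ * f z < 0
    exact mul_neg_of_pos_of_neg (inv_pos.2 hfv) (by linarith)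

/-- A positive functional of positive value at `v` is a multiple of a state. -/
theorem IsOrderUnitSpace.exists_mem_stateSpace_eq (hV : IsOrderUnitSpace V P v)
    {φ : V →ₗ[ℝ] ℝ} (hφ : ∀ p ∈ P, 0 ≤ φ p) (hφv : 0 < φ v) :
    ∃ ρ ∈ stateSpace P v, ∀ y, φ y = φ v * ρ y := by
  let f : V →L[ℝ] ℝ := φ.mkContinuous (φ v) (hV.abs_le_of_positive hφ)
  refine ⟨StrongDual.toWeakDual ((φ v)⁻¹ • f), ⟨fun p hp => ?_, ?_⟩, fun y => ?_⟩
  · change 0 ≤ (φ v)⁻¹ * φ p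
    exact mul_nonneg (inv_nonneg.2 hφv.le) (hφ p hp)
  · change (φ v)⁻¹ * φ v = 1
    exact inv_mul_cancel₀ hφv.ne'
  · change φ y = φ v * ((φ v)⁻¹ * φ y)
    rw [mul_inv_cancel_left₀ hφv.ne']

theorem IsOrderUnitSpace.exists_isPureState_neg (hV : IsOrderUnitSpace V P v) {z : V}
    (hz : z ∉ P) : ∃ σ : V →ₗ[ℝ] ℝ, IsPureState P v σ ∧ σ z < 0 := by
  obtain ⟨ρ₀, hρ₀, hρ₀z⟩ := hV.exists_mem_stateSpace_neg hz
  obtain ⟨μ, hμ, hμmin⟩ := hV.isCompact_stateSpace.exists_isMinOn ⟨ρ₀, hρ₀⟩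
    (WeakDual.eval_continuous z).continuousOn
  let F : Set (WeakDual ℝ V) := stateSpace P v ∩ {ρ | ρ z = μ z}
  have hF : IsCompact F := hV.isCompact_stateSpace.inter_right
    (isClosed_eq (WeakDual.eval_continuous z) continuous_const)
  have : LocallyConvexSpace ℝ (WeakDual ℝ V) :=
    inferInstanceAs (LocallyConvexSpace ℝ (WeakBilin (topDualPairing ℝ V)))
  obtain ⟨σ, hσF, hσext⟩ := hF.extremePoints_nonempty ⟨μ, hμ, rfl⟩
  have hσz : σ z = μ z := hσF.2
  obtain ⟨⟨hσpos, hσv⟩, -⟩ := hσF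
  refine ⟨(σ : V →L[ℝ] ℝ).toLinearMap, ⟨hσpos, hσv, fun φ hφ hφσ => ?_⟩, ?_⟩
  · change ∀ p ∈ P, φ p ≤ σ p at hφσ
    set ψ : V →ₗ[ℝ] ℝ := (σ : V →L[ℝ] ℝ).toLinearMap - φ with hψdef
    have hψ_apply : ∀ y, ψ y = σ y - φ y := fun y => rfl
    have hψ : ∀ p ∈ P, 0 ≤ ψ p := fun p hp => by
      rw [hψ_apply]
      linarith [hφσ p hp]
    have hsum : φ v + ψ v = 1 := by
      rw [hψ_apply, hσv]
      ring
    refine ⟨φ v, LinearMap.ext fun y => ?_⟩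
    change φ y = φ v * σ y
    rcases (hφ v hV.unit_mem).eq_or_lt with h0 | h0
    · have h := hV.abs_le_of_positive hφ y
      rw [← h0, zero_mul, abs_nonpos_iff] at h
      rw [h, ← h0, zero_mul]
    rcases (hψ v hV.unit_mem).eq_or_lt with h1 | h1
    · have h := hV.abs_le_of_positive hψ y
      rw [← h1, zero_mul, abs_nonpos_iff, hψ_apply] at h
      have : φ v = 1 := by linarith
      rw [this]
      linarith
    obtain ⟨ρ₁, hρ₁, hφρ⟩ := hV.exists_mem_stateSpace_eq hφ h0
    obtain ⟨ρ₂, hρ₂, hψρ⟩ := hV.exists_mem_stateSpace_eq hψ h1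
    have hσρ : ∀ y, σ y = φ v * ρ₁ y + ψ v * ρ₂ y := fun y => by
      rw [← hφρ, ← hψρ, hψ_apply]
      ring
    have hm₁ : μ z ≤ ρ₁ z := hμmin hρ₁
    have hm₂ : μ z ≤ ρ₂ z := hμmin hρ₂
    have hz' := hσρ z
    rw [hσz] at hz'
    have hz₁ : ρ₁ z = μ z := by
      have : φ v * (ρ₁ z - μ z) + ψ v * (ρ₂ z - μ z) = 0 := by linear_combination -hz' - μ z * hsum
      nlinarith [mul_nonneg h0.le (sub_nonneg.2 hm₁), mul_nonneg h1.le (sub_nonneg.2 hm₂)]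
    have hz₂ : ρ₂ z = μ z := by
      have : φ v * (ρ₁ z - μ z) + ψ v * (ρ₂ z - μ z) = 0 := by linear_combination -hz' - μ z * hsum
      nlinarith [mul_nonneg h0.le (sub_nonneg.2 hm₁), mul_nonneg h1.le (sub_nonneg.2 hm₂)]
    have hσ₁ : ρ₁ = σ := hσext ⟨hρ₁, hz₁⟩ ⟨hρ₂, hz₂⟩
      ⟨φ v, ψ v, h0, h1, hsum, DFunLike.ext _ _ fun y => (hσρ y).symm⟩
    rw [← hσ₁]
    exact hφρ y
  · change σ z < 0
    rw [hσz]
    exact (show μ z ≤ ρ₀ z from hμmin hρ₀).trans_lt hρ₀z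

theorem IsOrderUnitSpace.mem_of_forall_isPureState (hV : IsOrderUnitSpace V P v) {z : V}
    (h : ∀ σ : V →ₗ[ℝ] ℝ, IsPureState P v σ → 0 ≤ σ z) : z ∈ P := by
  by_contra hz
  obtain ⟨σ, hσ, hσz⟩ := hV.exists_isPureState_neg hz
  exact (h σ hσ).not_gt hσz

end PureStates

/-- `g` is the complement of `u` at `x`: `Φ x` is the sum of `Φ (x + u)` and `Φ (x + g)`. -/
def IsComplement {V W : Type*} [NormedAddCommGroup V] [NormedSpace ℝ V] [NormedAddCommGroup W]
    (P : Set V) (v : V) (Φ : V → W) (x u g : V) : Prop :=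
  u ∈ openCone P v ∧ g ∈ openCone P v ∧ Φ (x + u) + Φ (x + g) = Φ x

theorem IsComplement.symm {V W : Type*} [NormedAddCommGroup V] [NormedSpace ℝ V]
    [NormedAddCommGroup W] {P : Set V} {v : V} {Φ : V → W} {x u g : V}
    (h : IsComplement P v Φ x u g) : IsComplement P v Φ x g u :=
  ⟨h.2.1, h.1, by rw [add_comm]; exact h.2.2⟩

namespace GaugeReversing

variable {V : Type*} [NormedAddCommGroup V] [NormedSpace ℝ V] {P : Set V} {v : V}
variable {W : Type*} [NormedAddCommGroup W] [NormedSpace ℝ W] {Q : Set W} {w : W} {Φ : V → W}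

theorem sub_smul_mem_iff (hΦ : GaugeReversing P v Q w Φ) (hV : IsOrderUnitSpace V P v)
    (hW : IsOrderUnitSpace W Q w) {a z : V} (ha : a ∈ openCone P v) (hz : z ∈ openCone P v)
    {k : ℝ} (hk : 0 < k) : a - k • z ∈ P ↔ Φ z - k • Φ a ∈ Q := by
  rw [hΦ.2.2 _ (hV.smul_mem_openCone hk hz) a ha, hΦ.2.1 z hz k hk,
    ← hW.smul_mem_iff hk, smul_sub, smul_smul, mul_inv_cancel₀ hk.ne', one_smul]

theorem sub_one_add_smul_mem_iff (hΦ : GaugeReversing P v Q w Φ) (hV : IsOrderUnitSpace V P v)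
    (hW : IsOrderUnitSpace W Q w) {x z a : V} (hx : x ∈ openCone P v) (ha : a ∈ openCone P v)
    (hz : z ∈ openCone P v) (h : Φ z + Φ a = Φ x) {k : ℝ} (hk : 0 < k) :
    a - (1 + k) • x ∈ P ↔ a - k • z ∈ P := by
  rw [hΦ.sub_smul_mem_iff hV hW ha hz hk, hΦ.sub_smul_mem_iff hV hW ha hx (by positivity), ← h]
  have : Φ z + Φ a - (1 + k) • Φ a = Φ z - k • Φ a := by module
  rw [this]

theorem exists_isComplement (hΦ : GaugeReversing P v Q w Φ) (hV : IsOrderUnitSpace V P v)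
    (hW : IsOrderUnitSpace W Q w) {x u : V} (hx : x ∈ openCone P v) (hu : u ∈ openCone P v) :
    ∃ g, IsComplement P v Φ x u g := by
  have hxu : x + u ∈ openCone P v := hV.add_mem_openCone hx (hV.openCone_subset hu)
  obtain ⟨r, hr, h1⟩ := hV.exists_sub_smul_mem hu x
  have h2 : Φ x - (1 + r) • Φ (x + u) ∈ Q := by
    rw [← hΦ.sub_smul_mem_iff hV hW hxu hx (by positivity)]
    convert h1 using 1
    module
  have h3 : Φ x - Φ (x + u) ∈ openCone Q w := by
    refine hW.mem_openCone_of_sub_mem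
      (hW.smul_mem_openCone hr (hΦ.1.1 hxu)) ?_
    convert h2 using 1
    module
  obtain ⟨a, ha, hΦa⟩ := hΦ.1.2.2 h3
  obtain ⟨k, hk, h4⟩ := hV.exists_sub_smul_mem ha (x + u)
  rw [← hΦ.sub_one_add_smul_mem_iff hV hW hx ha hxu (by rw [hΦa]; abel) hk] at h4
  refine ⟨a - x, hu, hV.mem_openCone_of_sub_mem (hV.smul_mem_openCone hk hx) ?_, ?_⟩
  · convert h4 using 1
    module
  · rw [add_sub_cancel, hΦa]
    abel

theorem isComplement_antitone (hΦ : GaugeReversing P v Q w Φ) (hV : IsOrderUnitSpace V P v)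
    {x u g u' g' : V} (hx : x ∈ openCone P v) (h : IsComplement P v Φ x u g)
    (h' : IsComplement P v Φ x u' g') (huu' : u' - u ∈ P) : g - g' ∈ P := by
  have key : ∀ {z}, z ∈ openCone P v → x + z ∈ openCone P v := fun hz =>
    hV.add_mem_openCone hx (hV.openCone_subset hz)
  have h1 := (hΦ.2.2 _ (key h.1) _ (key h'.1)).1 (by convert huu' using 1; abel)
  have h2 := (hΦ.2.2 _ (key h'.2.1) _ (key h.2.1)).2 (by
    convert h1 using 1
    rw [sub_eq_sub_iff_add_eq_add, add_comm _ (Φ (x + u')), h'.2.2, h.2.2])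
  convert h2 using 1
  abel

theorem convex_mem (hΦ : GaugeReversing P v Q w Φ) (hV : IsOrderUnitSpace V P v)
    (hW : IsOrderUnitSpace W Q w) {a b : V} (ha : a ∈ openCone P v) (hb : b ∈ openCone P v)
    {θ : ℝ} (hθ0 : 0 < θ) (hθ1 : θ < 1) :
    (1 - θ) • Φ a + θ • Φ b - Φ ((1 - θ) • a + θ • b) ∈ Q := by
  have hθ' : 0 < 1 - θ := by linarith
  set z := (1 - θ) • a + θ • b with hz
  have hzC : z ∈ openCone P v := hV.add_mem_openCone (hV.smul_mem_openCone hθ' ha)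
    (hV.openCone_subset (hV.smul_mem_openCone hθ0 hb))
  refine hW.mem_of_forall_isPureState fun ρ hρ => ?_
  have hα := hρ.pos (hΦ.1.1 ha)
  have hβ := hρ.pos (hΦ.1.1 hb)
  set α := ρ (Φ a) with hαdef
  set β := ρ (Φ b) with hβdef
  set s := (1 - θ) * α⁻¹ + θ * β⁻¹ with hs
  have hs0 : 0 < s := by positivity
  have hsz : s * ρ (Φ z) ≤ 1 := by
    refine le_of_forall_pos_le_add fun η hη => ?_
    obtain ⟨c₁, hc₁, hc₁', hρ₁⟩ := hρ.exists_upper_bound hW (y := α⁻¹ • Φ a - w)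
      (by simp [← hαdef, hρ.2.1, hα.ne']) (half_pos hη)
    obtain ⟨c₂, hc₂, hc₂', hρ₂⟩ := hρ.exists_upper_bound hW (y := β⁻¹ • Φ b - w)
      (by simp [← hβdef, hρ.2.1, hβ.ne']) (half_pos hη)
    obtain ⟨p, hp, hΦp⟩ := hΦ.1.2.2
      (hW.add_mem_openCone hW.unit_mem_openCone (hW.add_mem _ hc₁ _ hc₂))
    have h1 : a - α⁻¹ • p ∈ P := by
      rw [hΦ.sub_smul_mem_iff hV hW ha hp (inv_pos.2 hα), hΦp]
      convert hW.add_mem _ hc₁' _ hc₂ using 1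
      module
    have h2 : b - β⁻¹ • p ∈ P := by
      rw [hΦ.sub_smul_mem_iff hV hW hb hp (inv_pos.2 hβ), hΦp]
      convert hW.add_mem _ hc₂' _ hc₁ using 1
      module
    have h3 : z - s • p ∈ P := by
      convert hV.add_mem _ (hV.smul_mem _ hθ'.le _ h1) _ (hV.smul_mem _ hθ0.le _ h2) using 1
      rw [hz, hs]
      module
    rw [hΦ.sub_smul_mem_iff hV hW hzC hp hs0, hΦp] at h3
    have h4 := hρ.le h3
    rw [map_smul, map_add, map_add, hρ.2.1, smul_eq_mul] at h4
    linarith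
  have hsM : 1 ≤ s * ((1 - θ) * α + θ * β) := by
    have : s * ((1 - θ) * α + θ * β) - 1 = θ * (1 - θ) * (α - β) ^ 2 / (α * β) := by
      rw [hs]
      field_simp
      ring
    have h0 : 0 ≤ θ * (1 - θ) * (α - β) ^ 2 / (α * β) := by positivity
    linarith
  have := le_of_mul_le_mul_left (hsz.trans hsM) hs0
  simp only [map_sub, map_add, map_smul, smul_eq_mul]
  linarith

theorem sub_smul_complement_smul_mem (hΦ : GaugeReversing P v Q w Φ)
    (hV : IsOrderUnitSpace V P v) (hW : IsOrderUnitSpace W Q w) {x u g h : V}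
    (hx : x ∈ openCone P v) {θ : ℝ} (hθ0 : 0 < θ) (hθ1 : θ < 1)
    (hg : IsComplement P v Φ x u g) (hh : IsComplement P v Φ x (θ • u) h) :
    x + g - θ • (x + h) ∈ P := by
  have key : ∀ {z}, z ∈ openCone P v → x + z ∈ openCone P v := fun hz =>
    hV.add_mem_openCone hx (hV.openCone_subset hz)
  have h1 := hΦ.convex_mem hV hW hx (key hg.1) hθ0 hθ1
  rw [show (1 - θ) • x + θ • (x + u) = x + θ • u by module] at h1
  rw [hΦ.sub_smul_mem_iff hV hW (key hg.2.1) (key hh.2.1) hθ0,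
    eq_sub_of_add_eq' hg.2.2, eq_sub_of_add_eq' hh.2.2]
  convert h1 using 1
  module

/-- A small increase of `g` at the pure state `σ` makes the order relations between `x` and the
complements visible at `σ`. -/
theorem exists_perturbation (hΦ : GaugeReversing P v Q w Φ)
    (hV : IsOrderUnitSpace V P v) (hW : IsOrderUnitSpace W Q w) {σ : V →ₗ[ℝ] ℝ}
    (hσ : IsPureState P v σ) {x ξ g h : V} (hx : x ∈ openCone P v)
    {θ : ℝ} (hθ0 : 0 < θ) (hθ1 : θ < 1)
    (hg : IsComplement P v Φ x ξ g) (hh : IsComplement P v Φ x (θ • ξ) h)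
    {δ τ : ℝ} (hδ0 : 0 < δ) (hδ1 : δ < 1) (hτ : 0 < τ) :
    ∃ g', g' - g ∈ P ∧ σ g' < σ g + τ ∧
      ∀ ξ' h', IsComplement P v Φ x ξ' g' → IsComplement P v Φ x (θ • ξ') h' →
        ξ - ξ' ∈ P ∧ h' - h ∈ P ∧ σ x * (σ x + σ g) ≤ (σ x + σ ξ) * σ g' ∧
        (1 - δ) * σ h * (σ x + θ * σ ξ') ≤ σ x * (σ x + σ h') := by
  have hX := hσ.pos hx
  have hξ := hσ.pos hg.1
  have hΓ := hσ.pos hg.2.1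
  have hH := hσ.pos hh.2.1
  have hδ' : 0 < 1 - δ := by linarith
  set k := (σ x + σ g) / (σ x + σ ξ) with hkdef
  set k' := (1 - δ) * σ h / σ x with hkdef'
  have hk : 0 < k := by positivity
  have hk' : 0 < k' := by positivity
  have hkmul : k * (σ x + σ ξ) = σ x + σ g := div_mul_cancel₀ _ (by positivity)
  have hkmul' : k' * σ x = (1 - δ) * σ h := div_mul_cancel₀ _ hX.ne'
  obtain ⟨c, hc, hcy, hσc⟩ := hσ.exists_upper_bound hV (y := k • (x + ξ) - (x + g))
    (by simp only [map_sub, map_smul, map_add, smul_eq_mul]; linarith) (half_pos hτ)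
  obtain ⟨c', hc', hcy', hσc'⟩ := hσ.exists_upper_bound hV (y := k' • x - (1 - δ) • h)
    (by simp only [map_sub, map_smul, smul_eq_mul]; linarith)
    (mul_pos hδ0 (half_pos hτ))
  have hδc' : δ⁻¹ • c' ∈ P := hV.smul_mem _ (inv_nonneg.2 hδ0.le) _ hc'
  have hg' : g + c + δ⁻¹ • c' - g ∈ P := by
    convert hV.add_mem _ hc _ hδc' using 1
    abel
  refine ⟨g + c + δ⁻¹ • c', hg', ?_, fun ξ' h' hξg hξh => ?_⟩
  · simp only [map_add, map_smul, smul_eq_mul]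
    have : δ⁻¹ * σ c' < τ / 2 := by rwa [inv_mul_lt_iff₀ hδ0]
    linarith
  have key : ∀ {z}, z ∈ openCone P v → x + z ∈ openCone P v := fun hz =>
    hV.add_mem_openCone hx (hV.openCone_subset hz)
  have hξξ : ξ - ξ' ∈ P := hΦ.isComplement_antitone hV hx hg.symm hξg.symm hg'
  have hhh : h' - h ∈ P := hΦ.isComplement_antitone hV hx hξh hh (by
    rw [← smul_sub]
    exact hV.smul_mem _ hθ0.le _ hξξ)
  have hhg : h' - (g + c + δ⁻¹ • c') ∈ P := hΦ.isComplement_antitone hV hx hξh hξg (by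
    convert hV.smul_mem (1 - θ) (by linarith) _ (hV.openCone_subset hξg.1) using 1
    module)
  refine ⟨hξξ, hhh, ?_, ?_⟩
  · have h1 : x + (g + c + δ⁻¹ • c') - k • (x + ξ') ∈ P := by
      convert hV.add_mem _ hcy _ (hV.add_mem _ hδc' _ (hV.smul_mem k hk.le _ hξξ)) using 1
      module
    rw [← hΦ.sub_one_add_smul_mem_iff hV hW hx (key hξg.2.1) (key hξg.1) hξg.2.2 hk] at h1
    have h2 := hσ.le h1
    rw [map_smul, map_add, smul_eq_mul] at h2
    have h3 : k * σ x ≤ σ (g + c + δ⁻¹ • c') := by linarith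
    have h4 := mul_le_mul_of_nonneg_left h3 (add_pos hX hξ).le
    linear_combination h4 - σ x * hkmul
  · have h1 : x + h' - (1 + k') • x ∈ P := by
      have hgc : g + c ∈ P := hV.add_mem _ (hV.openCone_subset hg.2.1) _ hc
      have h2 : h' - δ⁻¹ • c' ∈ P := by
        convert hV.add_mem _ hhg _ hgc using 1
        abel
      convert hV.add_mem _ hcy' _ (hV.add_mem _ (hV.smul_mem _ hδ'.le _ hhh) _
        (hV.smul_mem δ hδ0.le _ h2)) using 1
      rw [smul_sub δ, smul_smul, mul_inv_cancel₀ hδ0.ne']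
      module
    rw [hΦ.sub_one_add_smul_mem_iff hV hW hx (key hξh.2.1) (key hξh.1) hξh.2.2 hk'] at h1
    have h2 := hσ.le h1
    rw [map_smul, map_add, map_add, map_smul, smul_eq_mul, smul_eq_mul] at h2
    have h3 := mul_le_mul_of_nonneg_left h2 hX.le
    linear_combination h3 - (σ x + θ * σ ξ') * hkmul'

theorem le_of_forall_approx {X Γ U H θ B : ℝ} (hX : 0 < X) (hΓ : 0 < Γ) (hU : 0 < U)
    (hB : 0 < B) (hθ0 : 0 < θ) (hθ1 : θ < 1)
    (h : ∀ δ, 0 < δ → δ < 1 → ∃ Γ' Γ'' Ξ' Ξ'' H' H'' : ℝ, Γ ≤ Γ' ∧ Γ'' ≤ Γ + δ ∧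
      0 ≤ Ξ'' ∧ Ξ'' ≤ Ξ' ∧ Ξ' ≤ U ∧ Ξ' ≤ Ξ'' + δ ∧ H ≤ H' ∧ 0 ≤ H' ∧ H' ≤ B ∧ H'' ≤ H' + δ ∧
      X * (X + Γ') ≤ (X + Ξ') * Γ'' ∧ (1 - δ) * H' * (X + θ * Ξ'') ≤ X * (X + H'')) :
    θ * H ≤ Γ := by
  by_contra! hlt
  set Δ := θ * H - Γ with hΔdef
  have hΔ : 0 < Δ := by linarith
  set C := X + B * (X + U) + B with hC
  set K := Γ * C + (X + U) * (Γ + Δ) with hK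
  have hCpos : 0 < C := by positivity
  have hKpos : 0 < K := by positivity
  have key : ∀ δ, 0 < δ → δ < 1 → X ^ 2 * Δ ≤ δ * K := by
    intro δ hδ0 hδ1
    obtain ⟨Γ', Γ'', Ξ', Ξ'', H', H'', h1, h2, h3, h4, h5, h6, h7, h8, h9, h10, h11, h12⟩ :=
      h δ hδ0 hδ1
    have hΞ' : 0 ≤ Ξ' := h3.trans h4
    have e1 : X ^ 2 ≤ Ξ' * Γ + (X + U) * δ := by
      have a1 := mul_le_mul_of_nonneg_left h1 hX.le
      have a2 := mul_le_mul_of_nonneg_left h2 (add_nonneg hX.le hΞ')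
      have a3 := mul_le_mul_of_nonneg_right h5 hδ0.le
      linarith
    have e2 : Ξ' * (Γ + Δ) ≤ X ^ 2 + δ * C := by
      have a1 := mul_le_mul_of_nonneg_left h10 hX.le
      have a2 : H' * (X + θ * Ξ'') ≤ B * (X + U) := by
        refine mul_le_mul h9 ?_ (by positivity) hB.le
        have := mul_le_mul_of_nonneg_right hθ1.le h3
        linarith
      have a3 := mul_le_mul_of_nonneg_left a2 hδ0.le
      have a4 := mul_le_mul_of_nonneg_left h6 (mul_nonneg hθ0.le h8)
      have a5 : θ * H' * δ ≤ B * δ := by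
        refine mul_le_mul_of_nonneg_right ?_ hδ0.le
        have := mul_le_mul_of_nonneg_right hθ1.le h8
        linarith
      have a6 : Ξ' * (Γ + Δ) ≤ θ * H' * Ξ' := by
        have := mul_le_mul_of_nonneg_left h7 (mul_nonneg hθ0.le hΞ')
        rw [hΔdef]
        linarith
      rw [hC]
      linarith
    have a1 := mul_le_mul_of_nonneg_right e1 (add_pos hΓ hΔ).le
    have a2 := mul_le_mul_of_nonneg_right e2 hΓ.le
    rw [hK]
    linarith
  have hXΔ : 0 < X ^ 2 * Δ := by positivity
  have h1 := key (X ^ 2 * Δ / (K + X ^ 2 * Δ)) (by positivity)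
    ((div_lt_one (by positivity)).2 (by linarith))
  rw [div_mul_eq_mul_div, le_div_iff₀ (by positivity)] at h1
  nlinarith

theorem sub_smul_complement_mem (hΦ : GaugeReversing P v Q w Φ)
    (hV : IsOrderUnitSpace V P v) (hW : IsOrderUnitSpace W Q w) {x u g h : V}
    (hx : x ∈ openCone P v) {θ : ℝ} (hθ0 : 0 < θ) (hθ1 : θ < 1)
    (hg : IsComplement P v Φ x u g) (hh : IsComplement P v Φ x (θ • u) h) :
    g - θ • h ∈ P := by
  have hex : ∀ z, ∃ z', z ∈ openCone P v → IsComplement P v Φ x z z' := fun z => by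
    by_cases hz : z ∈ openCone P v
    · obtain ⟨z', hz'⟩ := hΦ.exists_isComplement hV hW hx hz
      exact ⟨z', fun _ => hz'⟩
    · exact ⟨0, fun h => absurd h hz⟩
  choose G hG using hex
  have hGθ : ∀ z ∈ openCone P v, IsComplement P v Φ x (θ • G z) (G (θ • G z)) := fun z hz =>
    hG _ (hV.smul_mem_openCone hθ0 (hG z hz).2.1)
  refine hV.mem_of_forall_isPureState fun σ hσ => ?_
  have hX := hσ.pos hx
  have hΓ := hσ.pos hg.2.1
  rw [map_sub, map_smul, smul_eq_mul, sub_nonneg]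
  refine le_of_forall_approx (B := (σ x + σ g + 1) / θ) hX hΓ (hσ.pos hg.1) (by positivity)
    hθ0 hθ1 fun δ hδ0 hδ1 => ?_
  let J : V → ℝ := fun z => σ (G (θ • G z)) - σ (G z)
  let T : Set V := {z | z - g ∈ P ∧ σ z < σ g + δ}
  have hTC : ∀ z ∈ T, z ∈ openCone P v := fun z hz => hV.mem_openCone_of_sub_mem hg.2.1 hz.1
  have hbd : ∀ z ∈ T, σ (G (θ • G z)) ≤ (σ x + σ g + 1) / θ := fun z hz => by
    have h1 := hσ.le (hΦ.sub_smul_complement_smul_mem hV hW hx hθ0 hθ1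
      (hG z (hTC z hz)).symm (hGθ z (hTC z hz)))
    rw [map_smul, map_add, map_add, smul_eq_mul] at h1
    rw [le_div_iff₀ hθ0]
    have := mul_pos hθ0 hX
    linarith [hz.2]
  have hbdd : BddAbove (J '' T) := by
    refine ⟨(σ x + σ g + 1) / θ, ?_⟩
    rintro _ ⟨z, hz, rfl⟩
    have := hσ.pos (hG z (hTC z hz)).2.1
    linarith [hbd z hz]
  have hne : (J '' T).Nonempty :=
    ⟨_, g, ⟨by simpa using hV.zero_mem, by linarith⟩, rfl⟩
  obtain ⟨_, ⟨g', hg'T, rfl⟩, hsup⟩ := exists_lt_of_lt_csSup hne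
    (show sSup (J '' T) - δ < sSup (J '' T) by linarith)
  have hg'C := hTC g' hg'T
  obtain ⟨g'', hgg, hσg, hrel⟩ := hΦ.exists_perturbation hV hW hσ hx hθ0 hθ1
    (hG g' hg'C).symm (hGθ g' hg'C) hδ0 hδ1 (sub_pos.2 hg'T.2)
  have hg''T : g'' ∈ T := by
    refine ⟨?_, by linarith⟩
    convert hV.add_mem _ hgg _ hg'T.1 using 1
    abel
  have hg''C := hTC g'' hg''T
  obtain ⟨r1, r2, r3, r4⟩ := hrel _ _ (hG g'' hg''C).symm (hGθ g'' hg''C)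
  have hJ : J g'' ≤ sSup (J '' T) := le_csSup hbdd ⟨g'', hg''T, rfl⟩
  have hug : u - G g' ∈ P :=
    hΦ.isComplement_antitone hV hx hg.symm (hG g' hg'C) hg'T.1
  have hhh : G (θ • G g') - h ∈ P := hΦ.isComplement_antitone hV hx (hGθ g' hg'C) hh (by
    rw [← smul_sub]
    exact hV.smul_mem _ hθ0.le _ hug)
  have s1 := hσ.le r1
  have s2 := hσ.le r2
  have hJlt : J g'' < J g' + δ := by linarith
  simp only [J] at hJlt
  exact ⟨σ g', σ g'', σ (G g'), σ (G g''), σ (G (θ • G g')), σ (G (θ • G g'')),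
    hσ.le hg'T.1, hg''T.2.le, (hσ.pos (hG g'' hg''C).2.1).le, s1, hσ.le hug, by linarith,
    hσ.le hhh, (hσ.pos (hGθ g' hg'C).2.1).le, hbd g' hg'T, by linarith, r3, r4⟩

theorem isComplement_smul (hΦ : GaugeReversing P v Q w Φ)
    (hV : IsOrderUnitSpace V P v) (hW : IsOrderUnitSpace W Q w) {x u g : V}
    (hx : x ∈ openCone P v) {θ : ℝ} (hθ0 : 0 < θ) (hθ1 : θ < 1)
    (hg : IsComplement P v Φ x u g) : IsComplement P v Φ x (θ • u) (θ⁻¹ • g) := by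
  obtain ⟨h, hh⟩ := hΦ.exists_isComplement hV hW hx (hV.smul_mem_openCone hθ0 hg.1)
  obtain ⟨k, hk⟩ := hΦ.exists_isComplement hV hW hx
    (hV.smul_mem_openCone (inv_pos.2 hθ0) hg.2.1)
  have h1 : θ⁻¹ • g - h ∈ P := by
    rw [← hV.smul_mem_iff hθ0]
    convert hΦ.sub_smul_complement_mem hV hW hx hθ0 hθ1 hg hh using 1
    rw [smul_sub, smul_smul, mul_inv_cancel₀ hθ0.ne', one_smul]
  have h2 : θ • u - k ∈ P := hΦ.isComplement_antitone hV hx hh.symm hk h1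
  have h3 : k - θ • u ∈ P := hΦ.sub_smul_complement_mem hV hW hx hθ0 hθ1 hk
    (by rw [smul_smul, mul_inv_cancel₀ hθ0.ne', one_smul]; exact hg.symm)
  have h4 := hV.proper _ h2 (by rwa [neg_sub])
  rw [sub_eq_zero.1 h4]
  exact hk.symm

theorem isComplement_smul_self (hΦ : GaugeReversing P v Q w Φ) (hV : IsOrderUnitSpace V P v)
    {x : V} (hx : x ∈ openCone P v) {β : ℝ} (hβ : 0 < β) :
    IsComplement P v Φ x (β • x) (β⁻¹ • x) := by
  refine ⟨hV.smul_mem_openCone hβ hx, hV.smul_mem_openCone (inv_pos.2 hβ) hx, ?_⟩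
  rw [show x + β • x = (1 + β) • x by module, show x + β⁻¹ • x = (1 + β⁻¹) • x by module,
    hΦ.2.1 x hx _ (by positivity), hΦ.2.1 x hx _ (by positivity), ← add_smul]
  have : (1 + β)⁻¹ + (1 + β⁻¹)⁻¹ = 1 := by
    field_simp
    ring
  rw [this, one_smul]

theorem tendsto_complement_deriv (hΦ : GaugeReversing P v Q w Φ)
    (hV : IsOrderUnitSpace V P v) (hW : IsOrderUnitSpace W Q w) {x u g : V}
    (hx : x ∈ openCone P v) (hg : IsComplement P v Φ x u g) {A : V →L[ℝ] W}
    (hA : HasFDerivAt Φ A x) :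
    Filter.Tendsto (fun t : ℝ => Φ (g + t • x)) (𝓝[>] 0) (𝓝 (-A u)) := by
  have h := ((hA.hasLineDerivAt u).tendsto_slope_zero_right).neg
  refine h.congr' ?_
  filter_upwards [Ioo_mem_nhdsGT one_pos] with t ⟨ht0, ht1⟩
  have h1 := (hΦ.isComplement_smul hV hW hx ht0 ht1 hg).2.2
  have hC : g + t • x ∈ openCone P v :=
    hV.add_mem_openCone hg.2.1 (hV.smul_mem t ht0.le _ (hV.openCone_subset hx))
  rw [show x + t⁻¹ • g = t⁻¹ • (g + t • x) by
    rw [smul_add, smul_smul, inv_mul_cancel₀ ht0.ne', one_smul, add_comm],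
    hΦ.2.1 _ hC _ (inv_pos.2 ht0), inv_inv] at h1
  rw [← h1, sub_add_cancel_left, smul_neg, neg_neg, smul_smul, inv_mul_cancel₀ ht0.ne', one_smul]

theorem sub_sub_deriv_mem (hΦ : GaugeReversing P v Q w Φ)
    (hV : IsOrderUnitSpace V P v) (hW : IsOrderUnitSpace W Q w) {x u : V}
    (hx : x ∈ openCone P v) (hu : u ∈ openCone P v) {A : V →L[ℝ] W}
    (hA : HasFDerivAt Φ A x) : Φ (x + u) - Φ x - A u ∈ Q := by
  obtain ⟨g, hg⟩ := hΦ.exists_isComplement hV hW hx hu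
  have h := (hΦ.tendsto_complement_deriv hV hW hx hg hA).sub_const (Φ (x + g))
  have h1 := hW.isClosed.mem_of_tendsto h (by
    filter_upwards [Ioo_mem_nhdsGT one_pos] with t ⟨ht0, ht1⟩
    have hxP := hV.openCone_subset hx
    refine (hΦ.2.2 _ (hV.add_mem_openCone hg.2.1 (hV.smul_mem t ht0.le _ hxP)) _
      (hV.add_mem_openCone hx (hV.openCone_subset hg.2.1))).1 ?_
    convert hV.smul_mem (1 - t) (by linarith) _ hxP using 1
    module)
  convert h1 using 1
  rw [← hg.2.2]
  abel

theorem add_deriv_add_sub_mem (hΦ : GaugeReversing P v Q w Φ)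
    (hV : IsOrderUnitSpace V P v) (hW : IsOrderUnitSpace W Q w) {x u : V}
    (hx : x ∈ openCone P v) (hu : u ∈ openCone P v) {β : ℝ} (hβ : 0 < β)
    (hux : β • x - u ∈ P) {A : V →L[ℝ] W} (hA : HasFDerivAt Φ A x) :
    Φ x + A u + β ^ 2 • Φ x - Φ (x + u) ∈ Q := by
  obtain ⟨g, hg⟩ := hΦ.exists_isComplement hV hW hx hu
  have hxP := hV.openCone_subset hx
  have h := (hΦ.tendsto_complement_deriv hV hW hx hg hA).const_sub (Φ g)
  have h1 := hW.isClosed.mem_of_tendsto h (by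
    filter_upwards [self_mem_nhdsWithin] with t ht
    have ht : 0 < t := ht
    refine (hΦ.2.2 _ hg.2.1 _ (hV.add_mem_openCone hg.2.1 (hV.smul_mem t ht.le _ hxP))).1 ?_
    rw [add_sub_cancel_left]
    exact hV.smul_mem t ht.le _ hxP)
  have hgx : g - β⁻¹ • x ∈ P :=
    hΦ.isComplement_antitone hV hx hg (hΦ.isComplement_smul_self hV hx hβ) hux
  have h2 := (hΦ.sub_smul_mem_iff hV hW hg.2.1 hx (inv_pos.2 hβ)).1 hgx
  have hxg : x + g ∈ openCone P v := hV.add_mem_openCone hx (hV.openCone_subset hg.2.1)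
  have h3 := (hΦ.2.2 _ hxg _ (hV.smul_mem_openCone (by positivity : 0 < 1 + β) hg.2.1)).1 (by
    convert hV.smul_mem β hβ.le _ hgx using 1
    rw [smul_sub, smul_smul, mul_inv_cancel₀ hβ.ne']
    module)
  rw [hΦ.2.1 g hg.2.1 _ (by positivity)] at h3
  have h4 := hW.smul_mem (β ^ 2 / (1 + β)) (by positivity) _
    (hW.openCone_subset (hΦ.1.1 hg.2.1))
  convert hW.add_mem _ h1 _ (hW.add_mem _ h3 _
    (hW.add_mem _ (hW.smul_mem (β ^ 2) (by positivity) _ h2) _ h4)) using 1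
  rw [eq_sub_of_add_eq hg.2.2]
  match_scalars <;> field_simp <;> ring

theorem add_deriv_add_smul_unit_sub_mem (hΦ : GaugeReversing P v Q w Φ)
    (hV : IsOrderUnitSpace V P v) (hW : IsOrderUnitSpace W Q w) (hΦv : Φ v = w) {x u : V}
    (hx : x ∈ openCone P v) (hu : u ∈ openCone P v) {l r : ℝ} (hl : 0 < l) (hr : 0 < r)
    (hxl : x - l⁻¹ • v ∈ P) (hur : r • v - u ∈ P) {A : V →L[ℝ] W} (hA : HasFDerivAt Φ A x) :
    Φ x + A u + (l ^ 3 * r ^ 2) • w - Φ (x + u) ∈ Q := by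
  have h1 := hΦ.add_deriv_add_sub_mem hV hW hx hu (mul_pos hl hr) (by
    convert hV.add_mem _ (hV.smul_mem (l * r) (by positivity) _ hxl) _ hur using 1
    rw [smul_sub, smul_smul, show l * r * l⁻¹ = r by field_simp]
    abel) hA
  have h2 := (hΦ.sub_smul_mem_iff hV hW hx hV.unit_mem_openCone (inv_pos.2 hl)).1 hxl
  rw [hΦv] at h2
  convert hW.add_mem _ h1 _ (hW.smul_mem (l ^ 3 * r ^ 2) (by positivity) _ h2) using 1
  match_scalars <;> field_simp
  ring

theorem smul_unit_sub_deriv_sub_mem (hΦ : GaugeReversing P v Q w Φ)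
    (hV : IsOrderUnitSpace V P v) (hW : IsOrderUnitSpace W Q w) (hΦv : Φ v = w) {x y u : V}
    (hx : x ∈ openCone P v) (hy : y ∈ openCone P v) (hu : u ∈ openCone P v) {l r d : ℝ}
    (hl : 0 < l) (hr : 0 < r) (hxl : x - l⁻¹ • v ∈ P) (hyl : y - l⁻¹ • v ∈ P)
    (hur : r • v - u ∈ P) (hd : ‖x - y‖ < d) {A B : V →L[ℝ] W}
    (hA : HasFDerivAt Φ A x) (hB : HasFDerivAt Φ B y) :
    (5 * l ^ 3 * d * r) • w - (A u - B u) ∈ Q := by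
  have hd0 : 0 < d := (norm_nonneg _).trans_lt hd
  obtain ⟨n1, n2⟩ := hV.norm_smul_add_mem_and_sub_mem (x - y)
  have hdv : (d - ‖x - y‖) • v ∈ openCone P v :=
    hV.smul_mem_openCone (sub_pos.2 hd) hV.unit_mem_openCone
  set p : V := (2⁻¹ : ℝ) • (d • v - (x - y)) with hp
  set q : V := (2⁻¹ : ℝ) • (d • v + (x - y)) with hq
  have hpC : p ∈ openCone P v := by
    refine hV.smul_mem_openCone (by norm_num) ?_
    convert hV.add_mem_openCone hdv n2 using 1
    module
  have hqC : q ∈ openCone P v := by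
    refine hV.smul_mem_openCone (by norm_num) ?_
    convert hV.add_mem_openCone hdv n1 using 1
    module
  have hpd : d • v - p ∈ P := by
    convert hV.openCone_subset hqC using 1
    module
  have hqd : d • v - q ∈ P := by
    convert hV.openCone_subset hpC using 1
    module
  have hpq : y + q = x + p := by module
  have ht : 0 < d / r := by positivity
  have htu : (d / r) • u ∈ openCone P v := hV.smul_mem_openCone ht hu
  have m1 := hΦ.sub_sub_deriv_mem hV hW hx
    (hV.add_mem_openCone hpC (hV.openCone_subset htu)) hA
  have m2 := hΦ.add_deriv_add_smul_unit_sub_mem hV hW hΦv hx hpC hl hd0 hxl hpd hA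
  have m3 := hΦ.sub_sub_deriv_mem hV hW hy hqC hB
  have m4 := hΦ.add_deriv_add_smul_unit_sub_mem hV hW hΦv hy
    (hV.add_mem_openCone hqC (hV.openCone_subset htu)) hl (by positivity : 0 < 2 * d) hyl (by
      convert hV.add_mem _ hqd _ (hV.smul_mem _ ht.le _ hur) using 1
      rw [smul_sub, smul_smul, div_mul_cancel₀ _ hr.ne']
      module) hB
  have hadd : ∀ (T : V →L[ℝ] W) (z : V), T (z + (d / r) • u) = T z + (d / r) • T u :=
    fun T z => by rw [map_add, map_smul]
  rw [← add_assoc, hadd] at m1 m4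
  rw [hpq] at m3 m4
  convert hW.smul_mem (r / d) (by positivity) _
    (hW.add_mem _ (hW.add_mem _ m1 _ m2) _ (hW.add_mem _ m3 _ m4)) using 1
  match_scalars <;> field_simp <;> ring

theorem norm_deriv_sub_deriv_le (hΦ : GaugeReversing P v Q w Φ)
    (hV : IsOrderUnitSpace V P v) (hW : IsOrderUnitSpace W Q w) (hΦv : Φ v = w) {x y u : V}
    (hx : x ∈ openCone P v) (hy : y ∈ openCone P v) (hu : u ∈ P) {l : ℝ}
    (hl : 0 < l) (hxl : x - l⁻¹ • v ∈ P) (hyl : y - l⁻¹ • v ∈ P) {A B : V →L[ℝ] W}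
    (hA : HasFDerivAt Φ A x) (hB : HasFDerivAt Φ B y) :
    ‖A u - B u‖ ≤ 5 * l ^ 3 * ‖x - y‖ * ‖u‖ := by
  have key : ∀ ε : ℝ, 0 < ε → ‖A (u + ε • v) - B (u + ε • v)‖ ≤
      5 * l ^ 3 * (‖x - y‖ + ε) * (‖u‖ + ε) := by
    intro ε hε
    have huC : u + ε • v ∈ openCone P v := by
      rw [add_comm]
      exact hV.add_mem_openCone (hV.smul_mem_openCone hε hV.unit_mem_openCone) hu
    have hur : (‖u‖ + ε) • v - (u + ε • v) ∈ P := by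
      convert (hV.norm_smul_add_mem_and_sub_mem u).2 using 1
      module
    have hr : 0 < ‖u‖ + ε := by positivity
    refine hW.norm_le (by positivity) ?_
      (hΦ.smul_unit_sub_deriv_sub_mem hV hW hΦv hx hy huC hl hr hxl hyl hur (by linarith) hA hB)
    convert hΦ.smul_unit_sub_deriv_sub_mem hV hW hΦv hy hx huC hl hr hyl hxl hur
      (d := ‖x - y‖ + ε) (by rw [norm_sub_rev]; linarith) hB hA using 1
    abel
  have h1 : Filter.Tendsto (fun ε : ℝ => ‖A (u + ε • v) - B (u + ε • v)‖) (𝓝[>] 0)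
      (𝓝 ‖A u - B u‖) := by
    have : Continuous fun ε : ℝ => ‖A (u + ε • v) - B (u + ε • v)‖ := by fun_prop
    simpa using (this.tendsto 0).mono_left nhdsWithin_le_nhds
  have h2 : Filter.Tendsto (fun ε : ℝ => 5 * l ^ 3 * (‖x - y‖ + ε) * (‖u‖ + ε)) (𝓝[>] 0)
      (𝓝 (5 * l ^ 3 * ‖x - y‖ * ‖u‖)) := by
    have : Continuous fun ε : ℝ => 5 * l ^ 3 * (‖x - y‖ + ε) * (‖u‖ + ε) := by fun_prop
    simpa using (this.tendsto 0).mono_left nhdsWithin_le_nhds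
  exact le_of_tendsto_of_tendsto h1 h2 (by
    filter_upwards [self_mem_nhdsWithin] with ε hε using key ε hε)

end GaugeReversing

/-- Let `Φ` be a gauge-reversing bijection between the open cones of
two complete order unit spaces with `Φ v = w`, and let `l > 0`. For `x, y` in the open
cone with `x ≥ l⁻¹ v` and `y ≥ l⁻¹ v`, and `A = DΦ(x)`, `B = DΦ(y)` the Fréchet
derivatives, one has `‖(A − B) u‖ ≤ 6 l³ ‖x − y‖ ‖u‖` for all `u ∈ P`, and
`‖A − B‖ ≤ 18 l³ ‖x − y‖` in the operator norm. -/
theorem gaugeReversing_deriv_lipschitz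
    {V : Type*} [NormedAddCommGroup V] [NormedSpace ℝ V] [CompleteSpace V]
    {W : Type*} [NormedAddCommGroup W] [NormedSpace ℝ W] [CompleteSpace W]
    (P : Set V) (v : V) (Q : Set W) (w : W)
    (hV : IsOrderUnitSpace V P v) (hW : IsOrderUnitSpace W Q w)
    (Φ : V → W) (hΦ : GaugeReversing P v Q w Φ) (hΦv : Φ v = w)
    (l : ℝ) (hl : 0 < l) (x y : V)
    (hx : x ∈ openCone P v) (hy : y ∈ openCone P v)
    (hxl : x - l⁻¹ • v ∈ P) (hyl : y - l⁻¹ • v ∈ P)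
    (A B : V →L[ℝ] W) (hA : HasFDerivAt Φ A x) (hB : HasFDerivAt Φ B y) :
    (∀ u ∈ P, ‖A u - B u‖ ≤ 6 * l ^ 3 * ‖x - y‖ * ‖u‖) ∧
    ‖A - B‖ ≤ 18 * l ^ 3 * ‖x - y‖ := by
  have key : ∀ u ∈ P, ‖A u - B u‖ ≤ 6 * l ^ 3 * ‖x - y‖ * ‖u‖ := fun u hu =>
    (hΦ.norm_deriv_sub_deriv_le hV hW hΦv hx hy hu hl hxl hyl hA hB).trans (by
      gcongr
      norm_num)
  refine ⟨key, ContinuousLinearMap.opNorm_le_bound _ (by positivity) fun u => ?_⟩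
  have hc : 0 ≤ 6 * l ^ 3 * ‖x - y‖ := by positivity
  have hv : ‖‖u‖ • v‖ ≤ ‖u‖ := by
    rw [norm_smul, norm_norm]
    exact mul_le_of_le_one_right (norm_nonneg u) hV.norm_unit_le
  have h1 := key _ (hV.norm_smul_add_mem_and_sub_mem u).1
  have h2 := key _ (hV.smul_mem _ (norm_nonneg u) v hV.unit_mem)
  have h3 := mul_le_mul_of_nonneg_left ((norm_add_le (‖u‖ • v) u).trans
    (add_le_add_left hv ‖u‖)) hc
  have h4 := mul_le_mul_of_nonneg_left hv hc
  have h5 : (A - B) u = (A (‖u‖ • v + u) - B (‖u‖ • v + u)) - (A (‖u‖ • v) - B (‖u‖ • v)) := by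
    rw [map_add, map_add, sub_apply]
    abel
  have h6 := norm_sub_le (A (‖u‖ • v + u) - B (‖u‖ • v + u)) (A (‖u‖ • v) - B (‖u‖ • v))
  rw [← h5] at h6
  linarith
end

section
/- Let (V, V₊, v) and (W, W₊, w) be complete order unit spaces with open cones C := V₊° and D := W₊°, and let Φ: C → D be a gauge-reversing bijection. Then Φ is continuously Fréchet differentiable: Φ is Fréchet differentiable at every point x of C (with respect to the norms ‖·‖_v and ‖·‖_w), and the map x ↦ DΦ(x) from C to the space L(V, W) of bounded linear operators with the operator norm is continuous. -/
open scoped Topology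

section ThompsonRelation

variable {V : Type*} [NormedAddCommGroup V] [NormedSpace ℝ V] {P : Set V} {v : V}

lemma IsOrderUnitSpace.comb_mem (hV : IsOrderUnitSpace V P v) {r s : ℝ} (hr : 0 ≤ r)
    (hs : 0 ≤ s) {x y : V} (hx : x ∈ P) (hy : y ∈ P) : r • x + s • y ∈ P :=
  hV.add_mem _ (hV.smul_mem r hr x hx) _ (hV.smul_mem s hs y hy)

lemma IsOrderUnitSpace.zero_mem_s18 (hV : IsOrderUnitSpace V P v) : (0 : V) ∈ P := by
  simpa using hV.smul_mem 0 le_rfl v hV.unit_mem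

lemma IsOrderUnitSpace.mem_of_mem_openCone (hV : IsOrderUnitSpace V P v) {x : V}
    (hx : x ∈ openCone P v) : x ∈ P := by
  obtain ⟨ε, hε, h⟩ := hx
  convert hV.comb_mem zero_le_one hε.le h hV.unit_mem using 1
  module

lemma IsOrderUnitSpace.mem_openCone_of_smul_le (hV : IsOrderUnitSpace V P v) {x y : V} {r : ℝ}
    (hr : 0 < r) (hx : x ∈ openCone P v) (h : y - r • x ∈ P) : y ∈ openCone P v := by
  obtain ⟨ε, hε, hx⟩ := hx
  refine ⟨r * ε, by positivity, ?_⟩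
  convert hV.comb_mem zero_le_one hr.le h hx using 1
  module

lemma IsOrderUnitSpace.unit_mem_openCone_s18 (hV : IsOrderUnitSpace V P v) : v ∈ openCone P v :=
  ⟨1, one_pos, by simpa using hV.zero_mem_s18⟩

lemma IsOrderUnitSpace.smul_mem_openCone_s18 (hV : IsOrderUnitSpace V P v) {x : V} {r : ℝ}
    (hr : 0 < r) (hx : x ∈ openCone P v) : r • x ∈ openCone P v :=
  hV.mem_openCone_of_smul_le hr hx (by simpa using hV.zero_mem_s18)

lemma IsOrderUnitSpace.smul_sub_mem_of_norm_lt (hV : IsOrderUnitSpace V P v) {x : V} {r : ℝ}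
    (h : ‖x‖ < r) : r • v - x ∈ P := by
  rw [hV.norm_eq] at h
  obtain ⟨s, ⟨-, -, hs⟩, hsr⟩ := exists_lt_of_csInf_lt (by
    obtain ⟨r₁, h₁, h₁'⟩ := hV.unit_order x
    obtain ⟨r₂, h₂, h₂'⟩ := hV.unit_order (-x)
    refine ⟨r₁ + r₂, by positivity, ?_, ?_⟩
    · convert hV.comb_mem zero_le_one h₁.le h₂' hV.unit_mem using 1
      module
    · convert hV.comb_mem zero_le_one h₂.le h₁' hV.unit_mem using 1
      module) h
  convert hV.comb_mem zero_le_one (sub_nonneg.2 hsr.le) hs hV.unit_mem using 1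
  module

lemma IsOrderUnitSpace.norm_le_s18 (hV : IsOrderUnitSpace V P v) {x : V} {r : ℝ} (hr : 0 ≤ r)
    (h₁ : x + r • v ∈ P) (h₂ : r • v - x ∈ P) : ‖x‖ ≤ r := by
  rw [hV.norm_eq]
  exact csInf_le ⟨0, fun s hs => hs.1⟩ ⟨hr, h₁, h₂⟩

/-- The points `a` and `b` of the open cone are at Thompson distance at most `t`. -/
structure ThompsonLE (P : Set V) (v : V) (t : ℝ) (a b : V) : Prop where
  nonneg : 0 ≤ t
  left_mem : a ∈ openCone P v
  right_mem : b ∈ openCone P v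
  left_le : Real.exp t • b - a ∈ P
  right_le : Real.exp t • a - b ∈ P

lemma ThompsonLE.symm {t : ℝ} {a b : V} (h : ThompsonLE P v t a b) : ThompsonLE P v t b a :=
  ⟨h.nonneg, h.right_mem, h.left_mem, h.right_le, h.left_le⟩

lemma ThompsonLE.trans (hV : IsOrderUnitSpace V P v) {s t : ℝ} {a b c : V}
    (h : ThompsonLE P v s a b) (h' : ThompsonLE P v t b c) : ThompsonLE P v (s + t) a c := by
  refine ⟨add_nonneg h.nonneg h'.nonneg, h.left_mem, h'.right_mem, ?_, ?_⟩
  · convert hV.comb_mem zero_le_one (Real.exp_pos s).le h.left_le h'.left_le using 1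
    rw [Real.exp_add]; module
  · convert hV.comb_mem zero_le_one (Real.exp_pos t).le h'.right_le h.right_le using 1
    rw [Real.exp_add]; module

lemma ThompsonLE.of_le_exp (hV : IsOrderUnitSpace V P v) {r t : ℝ} {a b : V} (ht : 0 ≤ t)
    (ha : a ∈ openCone P v) (hb : b ∈ openCone P v) (hr : r ≤ Real.exp t)
    (h₁ : r • b - a ∈ P) (h₂ : r • a - b ∈ P) : ThompsonLE P v t a b := by
  refine ⟨ht, ha, hb, ?_, ?_⟩
  · convert hV.comb_mem zero_le_one (sub_nonneg.2 hr) h₁ (hV.mem_of_mem_openCone hb) using 1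
    module
  · convert hV.comb_mem zero_le_one (sub_nonneg.2 hr) h₂ (hV.mem_of_mem_openCone ha) using 1
    module

lemma ThompsonLE.mono (hV : IsOrderUnitSpace V P v) {s t : ℝ} {a b : V}
    (h : ThompsonLE P v s a b) (hst : s ≤ t) : ThompsonLE P v t a b :=
  .of_le_exp hV (h.nonneg.trans hst) h.left_mem h.right_mem (Real.exp_le_exp.2 hst)
    h.left_le h.right_le

lemma ThompsonLE.refl (hV : IsOrderUnitSpace V P v) {t : ℝ} (ht : 0 ≤ t) {a : V}
    (ha : a ∈ openCone P v) : ThompsonLE P v t a a :=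
  .of_le_exp hV (r := 1) ht ha ha (Real.one_le_exp ht) (by simpa using hV.zero_mem_s18)
    (by simpa using hV.zero_mem_s18)

lemma ThompsonLE.map {W : Type*} [NormedAddCommGroup W] [NormedSpace ℝ W]
    {Q : Set W} {w : W} {Φ : V → W} (hV : IsOrderUnitSpace V P v)
    (hΦ : GaugeReversing P v Q w Φ) {t : ℝ} {a b : V} (h : ThompsonLE P v t a b) :
    ThompsonLE Q w t (Φ a) (Φ b) := by
  obtain ⟨hbij, hhom, hord⟩ := hΦ
  have key : ∀ {a b : V}, a ∈ openCone P v → b ∈ openCone P v → Real.exp t • b - a ∈ P →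
      Real.exp t • Φ a - Φ b ∈ Q := by
    intro a b ha hb h
    have ha' := hV.smul_mem_openCone_s18 (Real.exp_pos (-t)) ha
    rw [show Real.exp t • Φ a = Φ (Real.exp (-t) • a) by
      rw [hhom a ha _ (Real.exp_pos _), Real.exp_neg, inv_inv]]
    refine (hord _ ha' _ hb).1 ?_
    convert hV.smul_mem _ (Real.exp_pos (-t)).le _ h using 1
    rw [smul_sub, smul_smul, ← Real.exp_add]
    simp
  exact ⟨h.nonneg, hbij.mapsTo h.left_mem, hbij.mapsTo h.right_mem,
    key h.right_mem h.left_mem h.right_le, key h.left_mem h.right_mem h.left_le⟩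

lemma GaugeReversing.inverse {W : Type*} [NormedAddCommGroup W] [NormedSpace ℝ W]
    {Q : Set W} {w : W} {Φ : V → W} (hV : IsOrderUnitSpace V P v)
    (hΦ : GaugeReversing P v Q w Φ) {Ψ : W → V}
    (h : Set.InvOn Ψ Φ (openCone P v) (openCone Q w))
    (hΨ : Set.MapsTo Ψ (openCone Q w) (openCone P v)) : GaugeReversing Q w P v Ψ := by
  obtain ⟨hbij, hhom, hord⟩ := hΦ
  refine ⟨h.symm.bijOn hΨ hbij.mapsTo, ?_, ?_⟩
  · intro y hy r hr
    have := hhom _ (hΨ hy) r⁻¹ (inv_pos.2 hr)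
    rw [inv_inv, h.2 hy] at this
    rw [← this, h.1 (hV.smul_mem_openCone_s18 (inv_pos.2 hr) (hΨ hy))]
  · intro x hx y hy
    rw [hord _ (hΨ hy) _ (hΨ hx), h.2 hx, h.2 hy]

lemma ThompsonLE.norm_sub_le (hV : IsOrderUnitSpace V P v) {t N : ℝ} {a b : V}
    (h : ThompsonLE P v t a b) (ht' : t ≤ 1 / 2) (hN : 0 ≤ N)
    (ha : N • v - a ∈ P) : ‖a - b‖ ≤ 4 * t * N := by
  have ht := h.nonneg
  have he : Real.exp t ≤ 1 + 2 * t := by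
    have := Real.abs_exp_sub_one_sub_id_le (x := t) (by rw [abs_of_nonneg ht]; linarith)
    rw [abs_le] at this
    nlinarith
  have haP := hV.mem_of_mem_openCone h.left_mem
  have hbP := hV.mem_of_mem_openCone h.right_mem
  have h₁ : (1 + 2 * t) • b - a ∈ P := by
    convert hV.comb_mem zero_le_one (sub_nonneg.2 he) h.left_le hbP using 1
    module
  have h₂ : (1 + 2 * t) • a - b ∈ P := by
    convert hV.comb_mem zero_le_one (sub_nonneg.2 he) h.right_le haP using 1
    module
  have haN : (4 * t) • (N • v - a) ∈ P := hV.smul_mem _ (by positivity) _ ha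
  have h₃ : (4 * t * N) • v - (a - b) ∈ P → ‖a - b‖ ≤ 4 * t * N := fun h₃ => by
    refine hV.norm_le_s18 (by positivity) ?_ h₃
    convert hV.comb_mem zero_le_one zero_le_one (hV.comb_mem zero_le_one (by positivity : 0 ≤ 2 * t)
      h₂ haP) haN using 1
    module
  apply h₃
  convert hV.add_mem _ (hV.comb_mem zero_le_one (by positivity : 0 ≤ 2 * t) h₁ h₂) _
    (hV.comb_mem zero_le_one (by nlinarith : 0 ≤ 4 * t - 2 * t * (1 + 2 * t)) haN haP) using 1
  module

end ThompsonRelation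

section ApproximateReflections

/-- `τ` exchanges `a` and `b` and, as long as points stay within `S` of `a` and `b`, it is an
involution that expands the distance `R` by at most the factor `L`. -/
def ApproxReflection {X : Type*} (R : ℝ → X → X → Prop) (a b : X) (s₀ S L : ℝ)
    (τ : X → X) : Prop :=
  τ a = b ∧ τ b = a ∧ ∀ s, s₀ ≤ s → L * s ≤ S → ∀ z, R s z a → R s z b →
    τ (τ z) = z ∧ ∀ z', R s z' a → R s z' b → ∀ t, R t z z' → R (L * t) (τ z) (τ z')

variable {X : Type*} {R : ℝ → X → X → Prop} {a b : X} {s₀ S L θ : ℝ} {ρ τ : X → X}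

lemma ApproxReflection.mem (hτ : ApproxReflection R a b s₀ S L τ)
    (hrefl : ∀ t, 0 ≤ t → R t a a ∧ R t b b) (hab : ∀ t, s₀ ≤ t → R t a b ∧ R t b a)
    (hs₀ : 0 ≤ s₀) {s : ℝ} (hs : s₀ ≤ s) (hL : L * s ≤ S) {z : X} (ha : R s z a)
    (hb : R s z b) : R (L * s) (τ z) a ∧ R (L * s) (τ z) b := by
  have h := (hτ.2.2 s hs hL z ha hb).2
  have h₀ := hrefl s (hs₀.trans hs)
  have h₁ := hab s hs
  constructor
  · simpa [hτ.2.1] using h b h₁.2 h₀.2 s hb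
  · simpa [hτ.1] using h a h₀.1 h₁.1 s ha

lemma ApproxReflection.conj (hτ : ApproxReflection R a b s₀ S L τ)
    (hρ : ApproxReflection R a b s₀ S θ ρ)
    (hrefl : ∀ t, 0 ≤ t → R t a a ∧ R t b b) (hab : ∀ t, s₀ ≤ t → R t a b ∧ R t b a)
    (hs₀ : 0 ≤ s₀) (hL : 1 ≤ L) (hθ : 1 ≤ θ) :
    ApproxReflection R a b s₀ S (θ * L ^ 2) (fun z => τ (ρ (τ z))) := by
  refine ⟨by simp [hτ.1, hρ.2.1], by simp [hτ.2.1, hρ.1], ?_⟩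
  intro s hs hS z hza hzb
  have hs' : 0 ≤ s := hs₀.trans hs
  have e₁ : s ≤ L * s := le_mul_of_one_le_left hs' hL
  have e₂ : L * s ≤ θ * (L * s) := le_mul_of_one_le_left (by positivity) hθ
  have e₃ : θ * (L * s) ≤ L * (θ * (L * s)) := le_mul_of_one_le_left (by positivity) hL
  have e₄ : L * (θ * (L * s)) ≤ S := by linarith [show L * (θ * (L * s)) = θ * L ^ 2 * s by ring]
  have m₁ : ∀ y, R s y a → R s y b → _ := fun y =>
    hτ.mem hrefl hab hs₀ hs (by linarith) (z := y)
  have m₂ : ∀ y, R (L * s) y a → R (L * s) y b → _ := fun y =>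
    hρ.mem hrefl hab hs₀ (by linarith) (by linarith) (z := y)
  have key : ∀ y, R s y a → R s y b → R (θ * (L * s)) (ρ (τ y)) a ∧ R (θ * (L * s)) (ρ (τ y)) b :=
    fun y ha hb => m₂ _ (m₁ y ha hb).1 (m₁ y ha hb).2
  constructor
  · have h₁ := (hτ.2.2 _ (by linarith) e₄ _ (key z hza hzb).1 (key z hza hzb).2).1
    have h₂ := (hρ.2.2 _ (by linarith) (by linarith) _ (m₁ z hza hzb).1 (m₁ z hza hzb).2).1
    simp only [h₁, h₂]
    exact (hτ.2.2 _ hs (by linarith) _ hza hzb).1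
  · intro z' hza' hzb' t ht
    have h₁ := (hτ.2.2 _ hs (by linarith) _ hza hzb).2 _ hza' hzb' t ht
    have h₂ := (hρ.2.2 _ (by linarith) (by linarith) _ (m₁ z hza hzb).1 (m₁ z hza hzb).2).2 _
      (m₁ z' hza' hzb').1 (m₁ z' hza' hzb').2 _ h₁
    have h₃ := (hτ.2.2 _ (by linarith) e₄ _ (key z hza hzb).1 (key z hza hzb).2).2 _
      (key z' hza' hzb').1 (key z' hza' hzb').2 _ h₂
    convert h₃ using 1
    ring

/-- An approximate reflection almost fixes the centre `c` of `ρ`, because conjugating by it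
doubles the displacement of `c` while this displacement stays bounded. -/
lemma ApproxReflection.displacement_le (hρ : ApproxReflection R a b s₀ (4 * s₀) θ ρ)
    (hmono : ∀ s t x y, s ≤ t → R s x y → R t x y)
    (htrans : ∀ s t x y z, R s x y → R t y z → R (s + t) x z)
    (hsymm : ∀ t x y, R t x y → R t y x)
    (hrefl : ∀ t, 0 ≤ t → R t a a ∧ R t b b) (hab : R s₀ a b)
    (hs₀ : 0 ≤ s₀) (hθ : 1 ≤ θ) {c : X} (hca : R s₀ c a) (hcb : R s₀ c b)
    (hc : ∀ z, R (4 * s₀) z a → R (4 * s₀) z b → ∀ t, R t (ρ z) z → R (θ / 2 * t) z c)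
    (n : ℕ) : ∀ (L : ℝ) (τ : X → X), 1 ≤ L → ApproxReflection R a b s₀ (4 * s₀) L τ →
      (θ * L) ^ (2 ^ n) ≤ 2 → R (3 * s₀ * (θ * L) ^ (2 ^ n) / (θ * L * 2 ^ n)) (τ c) c := by
  have hab' : ∀ t, s₀ ≤ t → R t a b ∧ R t b a := fun t ht =>
    ⟨hmono _ _ _ _ ht hab, hmono _ _ _ _ ht (hsymm _ _ _ hab)⟩
  induction n with
  | zero =>
    intro L τ hL hτ hΛ
    have hL2 : L ≤ 2 := by
      refine le_trans ?_ hΛ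
      simpa using le_mul_of_one_le_left (by linarith) hθ
    have h₁ := (hτ.mem hrefl hab' hs₀ le_rfl (by nlinarith) hca hcb).1
    have h₂ := htrans _ _ _ _ _ h₁ (hsymm _ _ _ hca)
    refine hmono _ _ _ _ ?_ h₂
    have : 0 < θ * L := by positivity
    rw [pow_zero, pow_one, pow_zero, mul_one, mul_div_cancel_right₀ _ this.ne']
    nlinarith
  | succ n ih =>
    intro L τ hL hτ hΛ
    have hΛ1 : 1 ≤ θ * L := one_le_mul_of_one_le_of_one_le hθ hL
    have hsq : θ * (θ * L ^ 2) = (θ * L) ^ 2 := by ring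
    have hpow : (θ * (θ * L ^ 2)) ^ (2 ^ n) = (θ * L) ^ (2 ^ (n + 1)) := by
      rw [hsq, ← pow_mul, pow_succ']
    have hΛ2 : (θ * L) ^ 2 ≤ 2 :=
      (pow_le_pow_right₀ hΛ1 (Nat.le_self_pow n.succ_ne_zero 2)).trans hΛ
    have hL2 : 1 ≤ θ * L ^ 2 := one_le_mul_of_one_le_of_one_le hθ (one_le_pow₀ hL)
    have hτ' := hτ.conj hρ hrefl hab' hs₀ hL hθ
    have h := ih _ _ hL2 hτ' (by rw [hpow]; exact hΛ)
    rw [hpow, hsq] at h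
    have hLΛ : L ≤ θ * L := le_mul_of_one_le_left (by linarith) hθ
    have hθL : θ * L ^ 2 ≤ 2 := by nlinarith
    have hLL : θ * L ≤ 2 := by nlinarith
    have hL3 : L * (θ * L ^ 2) ≤ 4 := by nlinarith
    have e₁ : L * (θ * L ^ 2 * s₀) ≤ 4 * s₀ := by
      rw [← mul_assoc]
      exact mul_le_mul_of_nonneg_right hL3 hs₀
    have e₂ : θ * L ^ 2 * s₀ ≤ 4 * s₀ := by nlinarith
    have e₃ : s₀ ≤ θ * L ^ 2 * s₀ := le_mul_of_one_le_left hs₀ hL2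
    have e₄ : s₀ ≤ L * s₀ := le_mul_of_one_le_left hs₀ hL
    have e₅ : L * s₀ ≤ 4 * s₀ := by nlinarith
    have e₆ : θ * (L * s₀) ≤ 4 * s₀ := by nlinarith
    have e₇ : L * (θ * (L * s₀)) ≤ 4 * s₀ := by nlinarith
    have m := hτ'.mem hrefl hab' hs₀ le_rfl e₂ hca hcb
    have k := (hτ.2.2 _ e₃ e₁ _ m.1 m.2).2 c (hmono _ _ _ _ e₃ hca) (hmono _ _ _ _ e₃ hcb) _ h
    have m₁ := hτ.mem hrefl hab' hs₀ le_rfl e₅ hca hcb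
    have m₂ := hρ.mem hrefl hab' hs₀ e₄ e₆ m₁.1 m₁.2
    rw [(hτ.2.2 _ (by nlinarith) e₇ _ m₂.1 m₂.2).1] at k
    have := hc _ (hmono _ _ _ _ e₅ m₁.1) (hmono _ _ _ _ e₅ m₁.2) _ k
    convert this using 1
    have hθ0 : θ ≠ 0 := by positivity
    have hL0 : L ≠ 0 := by positivity
    field_simp
    ring

end ApproximateReflections

section MidpointEstimate

lemma exp_sub_one_le_half_mul_exp_add_one {t : ℝ} (ht : 0 ≤ t) :
    Real.exp t - 1 ≤ t / 2 * (Real.exp t + 1) := by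
  have h := Real.le_log_one_add_of_nonneg (sub_nonneg.2 (Real.one_le_exp ht))
  rw [add_sub_cancel, Real.log_exp, div_le_iff₀ (by linarith [Real.exp_pos t])] at h
  linarith

lemma exp_le_one_add_two_mul {t : ℝ} (ht : 0 ≤ t) (ht' : t ≤ 1 / 2) :
    Real.exp t ≤ 1 + 2 * t := by
  have := Real.abs_exp_sub_one_sub_id_le (x := t) (by rw [abs_of_nonneg ht]; linarith)
  rw [abs_le] at this
  nlinarith

variable {V : Type*} [NormedAddCommGroup V] [NormedSpace ℝ V] {P : Set V} {v : V}

lemma ThompsonLE.midpoint (hV : IsOrderUnitSpace V P v) {s : ℝ} {a b : V}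
    (h : ThompsonLE P v s a b) : ThompsonLE P v s ((1 / 2 : ℝ) • (a + b)) a := by
  have haP := hV.mem_of_mem_openCone h.left_mem
  have hbP := hV.mem_of_mem_openCone h.right_mem
  have he := Real.one_le_exp h.nonneg
  refine ⟨h.nonneg, hV.mem_openCone_of_smul_le one_half_pos h.left_mem ?_, h.left_mem, ?_, ?_⟩
  · convert hV.smul_mem (1 / 2) (by norm_num) b hbP using 1
    module
  · convert hV.comb_mem one_half_pos.le (by linarith : 0 ≤ (Real.exp s - 1) / 2) h.right_le haP
      using 1
    module
  · convert hV.comb_mem one_half_pos.le (by linarith : 0 ≤ (Real.exp s - 1) / 2) h.left_le haP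
      using 1
    module

lemma ThompsonLE.near_midpoint (hV : IsOrderUnitSpace V P v) {S : ℝ} {a b z : V}
    (hS' : S ≤ 1 / 4) (ha : ThompsonLE P v S z a) (hb : ThompsonLE P v S z b) :
    (1 + 2 * S) • ((1 / 2 : ℝ) • (a + b)) - z ∈ P ∧
      z - (1 - 2 * S) • ((1 / 2 : ℝ) • (a + b)) ∈ P := by
  have haP := hV.mem_of_mem_openCone ha.right_mem
  have hbP := hV.mem_of_mem_openCone hb.right_mem
  have hzP := hV.mem_of_mem_openCone ha.left_mem
  have hS := ha.nonneg
  have he := exp_le_one_add_two_mul hS (by linarith)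
  have hS2 : 0 ≤ (1 + 2 * S - Real.exp S) / 2 := by linarith
  have hS3 : 0 ≤ (1 - 2 * S) / 2 := by linarith
  constructor
  · convert hV.add_mem _ (hV.comb_mem one_half_pos.le one_half_pos.le ha.left_le hb.left_le) _
      (hV.comb_mem hS2 hS2 haP hbP) using 1
    module
  · convert hV.add_mem _ (hV.comb_mem hS3 hS3 ha.right_le hb.right_le) _
      (hV.smul_mem (1 - (1 - 2 * S) * Real.exp S) (by nlinarith) z hzP) using 1
    module

lemma IsOrderUnitSpace.midpoint_mem_openCone (hV : IsOrderUnitSpace V P v) {a b : V}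
    (ha : a ∈ openCone P v) (hb : b ∈ openCone P v) :
    (1 / 2 : ℝ) • (a + b) ∈ openCone P v :=
  hV.mem_openCone_of_smul_le one_half_pos ha (by
    convert hV.smul_mem (1 / 2) (by norm_num) b (hV.mem_of_mem_openCone hb) using 1
    module)

lemma IsOrderUnitSpace.approxReflection (hV : IsOrderUnitSpace V P v) {s₀ S : ℝ} {a b : V}
    (hS0 : 0 ≤ S) (hS : S ≤ 1 / 4) :
    ApproxReflection (ThompsonLE P v) a b s₀ S (1 + 8 * S) (fun z => a + b - z) := by
  refine ⟨by simp, by simp, fun s hs hsS z hza hzb => ⟨by simp, fun z' hza' hzb' t ht => ?_⟩⟩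
  have hs0 : 0 ≤ s := hza.nonneg
  have hsS' : s ≤ S := by nlinarith
  obtain ⟨h₁, -⟩ := ThompsonLE.near_midpoint hV hS (hza.mono hV hsS') (hzb.mono hV hsS')
  obtain ⟨h₃, -⟩ := ThompsonLE.near_midpoint hV hS (hza'.mono hV hsS') (hzb'.mono hV hsS')
  have hcC := hV.midpoint_mem_openCone hza.right_mem hzb.right_mem
  have hab : a + b = (2 : ℝ) • (1 / 2 : ℝ) • (a + b) := by module
  rw [hab]
  set c : V := (1 / 2 : ℝ) • (a + b)
  have hcP := hV.mem_of_mem_openCone hcC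
  have hS2 : 0 < 1 - 2 * S := by linarith
  have hexp : 1 + (1 + 8 * S) * (Real.exp t - 1) ≤ Real.exp ((1 + 8 * S) * t) := by
    have := one_add_mul_self_le_rpow_one_add (s := Real.exp t - 1)
      (by linarith [Real.exp_pos t]) (p := 1 + 8 * S) (by linarith)
    rw [add_sub_cancel, ← Real.exp_mul, mul_comm t] at this
    exact this
  have he : 0 ≤ Real.exp t - 1 := by linarith [Real.one_le_exp ht.nonneg]
  have key : ∀ y y' : V, (1 + 2 * S) • c - y ∈ P → (1 + 2 * S) • c - y' ∈ P →
      Real.exp t • y - y' ∈ P →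
      (1 + (1 + 8 * S) * (Real.exp t - 1)) • ((2 : ℝ) • c - y') - ((2 : ℝ) • c - y) ∈ P := by
    intro y y' hy hy' h
    convert hV.add_mem _ (hV.comb_mem zero_le_one he h hy) _
      (hV.comb_mem (by positivity : 0 ≤ (1 + 8 * S) * (Real.exp t - 1))
        (mul_nonneg he (by nlinarith : 0 ≤ (1 + 8 * S) * (1 - 2 * S) - (1 + 2 * S))) hy' hcP)
      using 1
    module
  refine .of_le_exp hV (mul_nonneg (by linarith) ht.nonneg) ?_ ?_ hexp
    (key _ _ h₁ h₃ ht.right_le) (key _ _ h₃ h₁ ht.left_le)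
  · refine hV.mem_openCone_of_smul_le hS2 hcC ?_
    convert h₁ using 1
    module
  · refine hV.mem_openCone_of_smul_le hS2 hcC ?_
    convert h₃ using 1
    module

lemma ThompsonLE.of_reflection (hV : IsOrderUnitSpace V P v) {S t : ℝ} {a b z : V}
    (hS : S ≤ 1 / 4) (ha : ThompsonLE P v S z a) (hb : ThompsonLE P v S z b)
    (h : ThompsonLE P v t (a + b - z) z) :
    ThompsonLE P v ((1 + 8 * S) / 2 * t) z ((1 / 2 : ℝ) • (a + b)) := by
  obtain ⟨-, h₁⟩ := ThompsonLE.near_midpoint hV hS ha hb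
  have hcC := hV.midpoint_mem_openCone ha.right_mem hb.right_mem
  have hab : a + b = (2 : ℝ) • (1 / 2 : ℝ) • (a + b) := by module
  have hl := h.left_le
  have hr := h.right_le
  rw [hab] at hl hr
  generalize (1 / 2 : ℝ) • (a + b) = c at *
  have hcP := hV.mem_of_mem_openCone hcC
  have hS0 := ha.nonneg
  have ht := h.nonneg
  have he := Real.exp_pos t
  have htanh := exp_sub_one_le_half_mul_exp_add_one ht
  have hd : Real.exp t + 1 ≠ 0 := by positivity
  have hi : 0 ≤ (Real.exp t + 1)⁻¹ := by positivity
  have h2 : 0 ≤ t / 2 - (Real.exp t - 1) * (Real.exp t + 1)⁻¹ := by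
    rw [sub_nonneg, ← div_eq_mul_inv, div_le_iff₀ (by positivity)]
    exact htanh
  have u₁ : (1 + t / 2) • c - z ∈ P := by
    convert hV.comb_mem hi h2 hr hcP using 1
    match_scalars <;> field_simp <;> ring
  have u₂ : z - (1 - t / 2) • c ∈ P := by
    convert hV.comb_mem hi h2 hl hcP using 1
    match_scalars <;> field_simp <;> ring
  refine .of_le_exp hV (by positivity) ha.left_mem hcC
    (by linarith [Real.add_one_le_exp ((1 + 8 * S) / 2 * t)] : 1 + (1 + 8 * S) / 2 * t ≤ _) ?_ ?_
  · convert hV.comb_mem zero_le_one (by positivity : 0 ≤ 4 * S * t) u₁ hcP using 1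
    module
  · convert hV.add_mem _ (hV.comb_mem zero_le_one (by positivity : 0 ≤ (1 + 8 * S) / 2 * t) u₂ h₁) _
      (hV.smul_mem ((1 + 8 * S) / 2 * t * (1 - 2 * S) - t / 2) (by
        nlinarith [mul_nonneg ht (mul_nonneg hS0 (by linarith : 0 ≤ 3 - 8 * S))]) c hcP) using 1
    module

variable {W : Type*} [NormedAddCommGroup W] [NormedSpace ℝ W] {Q : Set W} {w : W}

lemma ApproxReflection.transport {Φ : V → W} {Ψ : W → V} {s₀ S L : ℝ} {a b : V} {τ : W → W}
    (hV : IsOrderUnitSpace V P v) (hW : IsOrderUnitSpace W Q w)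
    (hΦ : GaugeReversing P v Q w Φ) (hΨ : GaugeReversing Q w P v Ψ)
    (hinv : Set.LeftInvOn Ψ Φ (openCone P v)) (hinv' : Set.LeftInvOn Φ Ψ (openCone Q w))
    (ha : a ∈ openCone P v) (hb : b ∈ openCone P v)
    (h : ApproxReflection (ThompsonLE Q w) (Φ a) (Φ b) s₀ S L τ) :
    ApproxReflection (ThompsonLE P v) a b s₀ S L (fun z => Ψ (τ (Φ z))) := by
  refine ⟨by simp [h.1, hinv hb], by simp [h.2.1, hinv ha], fun s hs hsS z hza hzb => ?_⟩
  have hz := h.2.2 s hs hsS _ (hza.map hV hΦ) (hzb.map hV hΦ)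
  have hm := hz.2 _ (hza.map hV hΦ) (hzb.map hV hΦ) 0
    (.refl hW le_rfl (hza.map hV hΦ).left_mem)
  constructor
  · simp only [hinv' hm.left_mem, hz.1, hinv hza.left_mem]
  · intro z' hza' hzb' t ht
    exact (hz.2 _ (hza'.map hV hΦ) (hzb'.map hV hΦ) t (ht.map hV hΦ)).map hW hΨ

lemma GaugeReversing.map_midpoint {Φ : V → W} (hV : IsOrderUnitSpace V P v)
    (hW : IsOrderUnitSpace W Q w) (hΦ : GaugeReversing P v Q w Φ) {s₀ : ℝ} {a b : V}
    (hs₀ : 0 < s₀) (hs₀' : s₀ ≤ 1 / 128) (hab : ThompsonLE P v s₀ a b) :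
    ThompsonLE Q w (1536 * s₀ ^ 2) (Φ ((1 / 2 : ℝ) • (a + b)))
      ((1 / 2 : ℝ) • (Φ a + Φ b)) := by
  set Ψ := Function.invFunOn Φ (openCone P v)
  have hinv : Set.InvOn Ψ Φ (openCone P v) (openCone Q w) := hΦ.1.invOn_invFunOn
  have hΨ : GaugeReversing Q w P v Ψ := hΦ.inverse hV hinv hΦ.1.surjOn.mapsTo_invFunOn
  have hS0 : 0 ≤ 4 * s₀ := by positivity
  have hS : 4 * s₀ ≤ 1 / 4 := by linarith
  have hθ : 1 ≤ 1 + 8 * (4 * s₀) := by linarith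
  have hab' := hab.map hV hΦ
  have hρ : ApproxReflection (ThompsonLE P v) a b s₀ (4 * s₀) _ _ := hV.approxReflection hS0 hS
  have hρ' : ApproxReflection (ThompsonLE Q w) (Φ a) (Φ b) s₀ (4 * s₀) _ _ :=
    hW.approxReflection hS0 hS
  have hτ := hρ'.transport hV hW hΦ hΨ hinv.1 hinv.2 hab.left_mem hab.right_mem
  have hca := hab.midpoint hV
  have hcb := hab.symm.midpoint hV
  rw [add_comm] at hcb
  obtain ⟨n, hn₁, hn₂⟩ := exists_nat_pow_near (x := (128 * s₀)⁻¹) (y := (2 : ℝ))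
    ((one_le_inv₀ (by positivity)).2 (by linarith)) one_lt_two
  have hn₃ : (2 : ℝ) ^ n * (128 * s₀) ≤ 1 := by
    rwa [← le_div_iff₀ (by positivity), one_div]
  have hn₄ : 1 ≤ (2 : ℝ) ^ (n + 1) * (128 * s₀) := by
    rw [← div_le_iff₀ (by positivity), one_div]
    exact hn₂.le
  have hΛ : ((1 + 8 * (4 * s₀)) * (1 + 8 * (4 * s₀))) ^ (2 ^ n) ≤ 2 := by
    have h₁ : 1 + 8 * (4 * s₀) ≤ Real.exp (32 * s₀) := by
      linarith [Real.add_one_le_exp (32 * s₀)]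
    calc ((1 + 8 * (4 * s₀)) * (1 + 8 * (4 * s₀))) ^ (2 ^ n)
        ≤ (Real.exp (32 * s₀) * Real.exp (32 * s₀)) ^ (2 ^ n) := by gcongr
      _ = Real.exp (2 ^ n * (64 * s₀)) := by
        rw [← Real.exp_add, ← Real.exp_nat_mul]; push_cast; ring_nf
      _ ≤ Real.exp (1 / 2) := Real.exp_le_exp.2 (by linarith)
      _ ≤ 2 := by linarith [exp_le_one_add_two_mul (t := 1 / 2) (by norm_num) le_rfl]
  have h := hρ.displacement_le (fun _ _ _ _ hst h => h.mono hV hst)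
    (fun _ _ _ _ _ h h' => h.trans hV h') (fun _ _ _ h => h.symm)
    (fun t ht => ⟨.refl hV ht hab.left_mem, .refl hV ht hab.right_mem⟩) hab hs₀.le hθ hca hcb
    (fun z hza hzb t ht => .of_reflection hV hS hza hzb ht) n _ _ hθ hτ hΛ
  have hca' := (hca.map hV hΦ).mono hW (by linarith : s₀ ≤ 4 * s₀)
  have hcb' := (hcb.map hV hΦ).mono hW (by linarith : s₀ ≤ 4 * s₀)
  have h' := h.map hV hΦ
  have hm := (hρ'.2.2 s₀ le_rfl (by nlinarith) _ (hca.map hV hΦ) (hcb.map hV hΦ)).2 _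
    (hca.map hV hΦ) (hcb.map hV hΦ) 0 (.refl hW le_rfl hca'.left_mem)
  simp only [hinv.2 hm.left_mem] at h'
  refine (ThompsonLE.of_reflection hW hS hca' hcb' h').mono hW ?_
  have hθ2 : (1 + 8 * (4 * s₀)) ≤ 2 := by linarith
  set θ := 1 + 8 * (4 * s₀)
  have hθ0 : 0 < θ := by linarith
  calc θ / 2 * (3 * s₀ * (θ * θ) ^ 2 ^ n / (θ * θ * 2 ^ n))
      ≤ θ / 2 * (3 * s₀ * 2 / (θ * θ * 2 ^ n)) := by gcongr
    _ = 3 * s₀ / (θ * 2 ^ n) := by field_simp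
    _ ≤ 3 * s₀ / 2 ^ n := by
      gcongr
      exact le_mul_of_one_le_left (by positivity) hθ
    _ ≤ 1536 * s₀ ^ 2 := by
      rw [div_le_iff₀ (by positivity)]
      rw [pow_succ] at hn₄
      nlinarith

end MidpointEstimate

section SecondDifferences

variable {V : Type*} [NormedAddCommGroup V] [NormedSpace ℝ V]
variable {W : Type*} [NormedAddCommGroup W] [NormedSpace ℝ W]

/-- A locally Lipschitz map with quadratically small second differences near `x₀` has
derivatives near `x₀`, with a uniform quadratic remainder. -/
lemma exists_derivative_of_second_difference_le [CompleteSpace W] {f : V → W} {x₀ : V}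
    {δ K L : ℝ} (hδ : 0 < δ) (hK : 0 ≤ K)
    (hlip : ∀ x ∈ Metric.ball x₀ δ, ∀ h : V, ‖h‖ ≤ δ → ‖f (x + h) - f x‖ ≤ L * ‖h‖)
    (hsec : ∀ x ∈ Metric.ball x₀ δ, ∀ h : V, ‖h‖ ≤ δ →
      ‖f (x + h) + f (x - h) - (2 : ℝ) • f x‖ ≤ K * ‖h‖ ^ 2)
    {x : V} (hx : x ∈ Metric.ball x₀ (δ / 2)) :
    ∃ D : V →L[ℝ] W, ∀ h : V, ‖h‖ ≤ δ / 4 → ‖f (x + h) - f x - D h‖ ≤ K * ‖h‖ ^ 2 := by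
  set q : ℕ → V → W := fun n h => (2 : ℝ) ^ n • (f (x + ((2 : ℝ) ^ n)⁻¹ • h) - f x) with hq
  have hball : ∀ u : V, ‖u‖ ≤ δ / 4 → x + u ∈ Metric.ball x₀ δ := fun u hu => by
    rw [mem_ball_iff_norm] at hx ⊢
    calc ‖x + u - x₀‖ = ‖(x - x₀) + u‖ := by congr 1; abel
      _ ≤ ‖x - x₀‖ + ‖u‖ := norm_add_le _ _
      _ < δ := by linarith
  have hnorm : ∀ (n : ℕ) (h : V), ‖((2 : ℝ) ^ n)⁻¹ • h‖ = ((2 : ℝ) ^ n)⁻¹ * ‖h‖ := fun n h => by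
    rw [norm_smul, Real.norm_of_nonneg (by positivity)]
  have hpow : ∀ n : ℕ, ((2 : ℝ) ^ n)⁻¹ ≤ 1 := fun n => inv_le_one_of_one_le₀ (one_le_pow₀ one_le_two)
  have hsmall : ∀ h : V, ∀ r > 0, ∀ᶠ n : ℕ in Filter.atTop, ‖((2 : ℝ) ^ n)⁻¹ • h‖ ≤ r := by
    intro h r hr
    have : Filter.Tendsto (fun n : ℕ => ‖((2 : ℝ) ^ n)⁻¹ • h‖) Filter.atTop (𝓝 0) := by
      simp_rw [hnorm, ← inv_pow]
      simpa using (tendsto_pow_atTop_nhds_zero_of_lt_one (by norm_num : (0 : ℝ) ≤ 2⁻¹)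
        (by norm_num)).mul_const ‖h‖
    exact this.eventually_le_const hr
  have hstep : ∀ h : V, ‖h‖ ≤ δ / 4 → ∀ n, dist (q n h) (q (n + 1) h) ≤
      K * ‖h‖ ^ 2 / 2 / 2 ^ n := by
    intro h hh n
    set u : V := ((2 : ℝ) ^ (n + 1))⁻¹ • h with hu
    have hun : ‖u‖ = ((2 : ℝ) ^ (n + 1))⁻¹ * ‖h‖ := hnorm _ _
    have hu4 : ‖u‖ ≤ δ / 4 := by
      rw [hun]
      exact (mul_le_of_le_one_left (norm_nonneg _) (hpow _)).trans hh
    have h2 : ((2 : ℝ) ^ n)⁻¹ • h = u + u := by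
      rw [hu, ← two_smul ℝ, smul_smul, pow_succ]
      congr 1
      field_simp
    have hs := hsec (x + u) (hball u hu4) u (by linarith)
    rw [add_sub_cancel_right] at hs
    have : q n h - q (n + 1) h = (2 : ℝ) ^ n • (f (x + u + u) + f x - (2 : ℝ) • f (x + u)) := by
      have q₀ : q n h = (2 : ℝ) ^ n • (f (x + u + u) - f x) := by
        simp only [hq]
        rw [h2, add_assoc]
      have q₁ : q (n + 1) h = ((2 : ℝ) ^ n * 2) • (f (x + u) - f x) := by
        rw [← pow_succ]
      rw [q₀, q₁]
      module
    rw [dist_eq_norm, this, norm_smul, Real.norm_of_nonneg (by positivity)]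
    calc (2 : ℝ) ^ n * _ ≤ 2 ^ n * (K * ‖u‖ ^ 2) := by gcongr
      _ = K * ‖h‖ ^ 2 / 4 / 2 ^ n := by
        rw [hun, pow_succ]
        field_simp
        ring
      _ ≤ _ := by gcongr; norm_num
  have hlim : ∀ h : V, ∃ y, Filter.Tendsto (fun n => q n h) Filter.atTop (𝓝 y) := by
    intro h
    obtain ⟨m, hm⟩ := (hsmall h (δ / 4) (by linarith)).exists
    obtain ⟨y, hy⟩ := cauchySeq_tendsto_of_complete (cauchySeq_of_le_geometric_two (hstep _ hm))
    refine ⟨(2 : ℝ) ^ m • y, (Filter.tendsto_add_atTop_iff_nat m).1 ?_⟩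
    refine (hy.const_smul ((2 : ℝ) ^ m)).congr fun n => ?_
    simp only [hq, smul_smul, pow_add, mul_inv]
    rw [mul_comm]
  choose D hD using hlim
  have hadd : ∀ h k, D (h + k) = D h + D k := by
    intro h k
    have ht : Filter.Tendsto (fun n => q n h + q n k - q (n + 1) (h + k)) Filter.atTop
        (𝓝 (D h + D k - D (h + k))) :=
      ((hD h).add (hD k)).sub ((Filter.tendsto_add_atTop_iff_nat 1).2 (hD (h + k)))
    have h0 : Filter.Tendsto (fun n => q n h + q n k - q (n + 1) (h + k)) Filter.atTop (𝓝 0) := by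
      have hb : Filter.Tendsto (fun n : ℕ => K * ‖h - k‖ ^ 2 * (2⁻¹ : ℝ) ^ n) Filter.atTop (𝓝 0) := by
        simpa using (tendsto_pow_atTop_nhds_zero_of_lt_one (by norm_num : (0 : ℝ) ≤ 2⁻¹)
          (by norm_num)).const_mul (K * ‖h - k‖ ^ 2)
      refine squeeze_zero_norm' ?_ hb
      filter_upwards [hsmall (h + k) (δ / 4) (by linarith), hsmall (h - k) (δ / 4) (by linarith)]
        with n h₁ h₂
      have hc : ∀ z : V, ((2 : ℝ) ^ (n + 1))⁻¹ • z = (1 / 2 : ℝ) • ((2 : ℝ) ^ n)⁻¹ • z := by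
        intro z
        rw [smul_smul, pow_succ, mul_inv, mul_comm, one_div]
      set e : ℝ := ((2 : ℝ) ^ n)⁻¹ with he
      have n₁ : ‖(1 / 2 : ℝ) • e • (h + k)‖ ≤ δ / 4 := by
        rw [norm_smul, Real.norm_of_nonneg (by norm_num)]; linarith [norm_nonneg (e • (h + k))]
      have n₂ : ‖(1 / 2 : ℝ) • e • (h - k)‖ = 1 / 2 * (e * ‖h - k‖) := by
        rw [norm_smul, Real.norm_of_nonneg (by norm_num), he, hnorm]
      have n₃ : ‖(1 / 2 : ℝ) • e • (h - k)‖ ≤ δ := by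
        rw [norm_smul, Real.norm_of_nonneg (by norm_num)]; linarith [norm_nonneg (e • (h - k))]
      have hs := hsec _ (hball _ n₁) _ n₃
      rw [show x + (1 / 2 : ℝ) • e • (h + k) + (1 / 2 : ℝ) • e • (h - k) = x + e • h by module,
        show x + (1 / 2 : ℝ) • e • (h + k) - (1 / 2 : ℝ) • e • (h - k) = x + e • k by module] at hs
      have : q n h + q n k - q (n + 1) (h + k) = (2 : ℝ) ^ n • (f (x + e • h) + f (x + e • k) -
          (2 : ℝ) • f (x + (1 / 2 : ℝ) • e • (h + k))) := by
        simp only [hq, hc]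
        rw [pow_succ]
        module
      rw [this, norm_smul, Real.norm_of_nonneg (by positivity)]
      calc (2 : ℝ) ^ n * _ ≤ 2 ^ n * (K * ‖(1 / 2 : ℝ) • e • (h - k)‖ ^ 2) := by gcongr
        _ = K * ‖h - k‖ ^ 2 * 2⁻¹ ^ n / 4 := by
          rw [n₂, he, inv_pow]
          field_simp
          ring
        _ ≤ _ := div_le_self (by positivity) (by norm_num)
    have := tendsto_nhds_unique ht h0
    exact (sub_eq_zero.1 this).symm
  have hbound : ∀ h, ‖D h‖ ≤ L * ‖h‖ := by
    intro h
    refine le_of_tendsto (hD h).norm ?_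
    filter_upwards [hsmall h δ hδ] with n hn
    have hx' : x ∈ Metric.ball x₀ δ := Metric.ball_subset_ball (by linarith) hx
    have := hlip x hx' _ hn
    rw [hq, norm_smul, Real.norm_of_nonneg (by positivity)]
    calc (2 : ℝ) ^ n * _ ≤ 2 ^ n * (L * ‖((2 : ℝ) ^ n)⁻¹ • h‖) := by gcongr
      _ = L * ‖h‖ := by rw [hnorm]; field_simp
  let A : V →+ W := AddMonoidHom.mk' D hadd
  have hA : Continuous A := AddMonoidHomClass.continuous_of_bound A L hbound
  refine ⟨A.toRealLinearMap hA, fun h hh => ?_⟩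
  have := dist_le_of_le_geometric_two_of_tendsto₀ (hstep h hh) (hD h)
  simpa [hq, dist_eq_norm, A] using this

lemma exists_continuousOn_fderiv [CompleteSpace W] {f : V → W} {U : Set V}
    (hU : ∀ x₀ ∈ U, ∃ δ K L : ℝ, 0 < δ ∧ 0 ≤ K ∧
      (∀ x ∈ Metric.ball x₀ δ, ∀ h : V, ‖h‖ ≤ δ → ‖f (x + h) - f x‖ ≤ L * ‖h‖) ∧
      (∀ x ∈ Metric.ball x₀ δ, ∀ h : V, ‖h‖ ≤ δ →
        ‖f (x + h) + f (x - h) - (2 : ℝ) • f x‖ ≤ K * ‖h‖ ^ 2)) :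
    ∃ D' : V → (V →L[ℝ] W), (∀ x ∈ U, HasFDerivAt f (D' x) x) ∧ ContinuousOn D' U := by
  have hder : ∀ {x : V} {D : V →L[ℝ] W} {K δ : ℝ}, 0 < δ →
      (∀ h : V, ‖h‖ ≤ δ → ‖f (x + h) - f x - D h‖ ≤ K * ‖h‖ ^ 2) → HasFDerivAt f D x := by
    intro x D K δ hδ h
    rw [hasFDerivAt_iff_isLittleO_nhds_zero]
    refine Asymptotics.IsBigO.trans_isLittleO (g := fun h : V => ‖h‖ ^ 2) ?_ ?_
    · refine Asymptotics.IsBigO.of_bound K ?_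
      filter_upwards [Metric.closedBall_mem_nhds (0 : V) hδ] with k hk
      simpa using h k (by simpa using hk)
    · exact Asymptotics.isLittleO_norm_pow_id one_lt_two
  refine ⟨fderiv ℝ f, fun x₀ hx₀ => ?_, fun x₀ hx₀ => ?_⟩
  · obtain ⟨δ, K, L, hδ, hK, hlip, hsec⟩ := hU x₀ hx₀
    obtain ⟨D, hD⟩ := exists_derivative_of_second_difference_le hδ hK hlip hsec
      (Metric.mem_ball_self (half_pos hδ))
    exact (hder (by linarith) hD).differentiableAt.hasFDerivAt
  · obtain ⟨δ, K, L, hδ, hK, hlip, hsec⟩ := hU x₀ hx₀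
    have hrem : ∀ x ∈ Metric.ball x₀ (δ / 2), ∀ h : V, ‖h‖ ≤ δ / 4 →
        ‖f (x + h) - f x - fderiv ℝ f x h‖ ≤ K * ‖h‖ ^ 2 := by
      intro x hx
      obtain ⟨D, hD⟩ := exists_derivative_of_second_difference_le hδ hK hlip hsec hx
      rwa [(hder (by linarith) hD).fderiv]
    have hx₀' := Metric.mem_ball_self (x := x₀) (half_pos hδ)
    have hL : ∀ x ∈ Metric.ball x₀ δ, ∀ y, ‖y - x‖ ≤ δ → ‖f y - f x‖ ≤ |L| * ‖y - x‖ := by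
      intro x hx y hy
      have := hlip x hx (y - x) hy
      rw [add_sub_cancel] at this
      exact this.trans (mul_le_mul_of_nonneg_right (le_abs_self L) (norm_nonneg _))
    refine ContinuousAt.continuousWithinAt (Metric.continuousAt_iff.2 fun ε hε => ?_)
    set r : ℝ := min (δ / 4) (ε / (8 * (K + 1))) with hr
    have hr0 : 0 < r := by positivity
    have hr1 : r ≤ δ / 4 := min_le_left _ _
    have hr2 : K * r ≤ ε / 8 := by
      have : r ≤ ε / (8 * (K + 1)) := min_le_right _ _
      rw [le_div_iff₀ (by positivity)] at this
      nlinarith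
    refine ⟨min (δ / 2) (ε * r / (16 * (|L| + 1))), by positivity, fun x hx => ?_⟩
    have hx1 : x ∈ Metric.ball x₀ (δ / 2) := lt_of_lt_of_le hx (min_le_left _ _)
    have hx2 : |L| * ‖x - x₀‖ ≤ ε * r / 16 := by
      have : dist x x₀ ≤ ε * r / (16 * (|L| + 1)) := (lt_of_lt_of_le hx (min_le_right _ _)).le
      rw [le_div_iff₀ (by positivity), dist_eq_norm] at this
      nlinarith [norm_nonneg (x - x₀)]
    have hx3 : ‖x - x₀‖ ≤ δ / 2 := by
      rw [← dist_eq_norm]; exact hx1.le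
    rw [dist_eq_norm]
    refine lt_of_le_of_lt (ContinuousLinearMap.opNorm_le_of_shell' (𝕜 := ℝ) (ε := r)
      (C := ε / 2) (c := (1 / 2 : ℝ)) hr0 (by positivity) (by norm_num) fun h h₁ h₂ => ?_)
      (half_lt_self hε)
    have h₁' : r ≤ 2 * ‖h‖ := by
      rw [Real.norm_of_nonneg (by norm_num)] at h₁
      linarith
    have hh : ‖h‖ ≤ δ / 4 := h₂.le.trans hr1
    have e₁ := hrem x hx1 h hh
    have e₂ := hrem x₀ hx₀' h hh
    have e₃ := hL x₀ (Metric.mem_ball_self hδ) x (by linarith)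
    have e₄ := hL (x₀ + h) (by rw [mem_ball_iff_norm, add_sub_cancel_left]; linarith) (x + h)
      (by rw [add_sub_add_right_eq_sub]; linarith)
    rw [add_sub_add_right_eq_sub] at e₄
    have hquad : K * ‖h‖ ^ 2 ≤ ε / 8 * ‖h‖ := by
      have : K * ‖h‖ ≤ ε / 8 := (mul_le_mul_of_nonneg_left h₂.le hK).trans hr2
      nlinarith [norm_nonneg h]
    have hlin : ε * r ≤ ε * (2 * ‖h‖) := mul_le_mul_of_nonneg_left h₁' hε.le
    calc ‖(fderiv ℝ f x - fderiv ℝ f x₀) h‖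
        = ‖(f (x₀ + h) - f x₀ - fderiv ℝ f x₀ h) - (f (x + h) - f x - fderiv ℝ f x h) +
            ((f (x + h) - f (x₀ + h)) - (f x - f x₀))‖ := by
          rw [sub_apply]
          congr 1
          abel
      _ ≤ _ := (norm_add_le _ _).trans (add_le_add (norm_sub_le _ _) (norm_sub_le _ _))
      _ ≤ ε / 2 * ‖h‖ := by linarith

end SecondDifferences

section OrderUnitEstimates

variable {V : Type*} [NormedAddCommGroup V] [NormedSpace ℝ V] {P : Set V} {v : V}
variable {W : Type*} [NormedAddCommGroup W] [NormedSpace ℝ W] {Q : Set W} {w : W}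

/-- Vectors of norm below `ε * q` are dominated by `q • x` whenever `ε • v ≤ x`. -/
lemma IsOrderUnitSpace.smul_sub_mem_of_norm_lt_mul (hV : IsOrderUnitSpace V P v) {ε q : ℝ}
    {x h : V} (hx : x - ε • v ∈ P) (hq : 0 ≤ q) (hh : ‖h‖ < ε * q) : q • x - h ∈ P := by
  convert hV.comb_mem hq zero_le_one hx (hV.smul_sub_mem_of_norm_lt hh) using 1
  module

/-- The line segment through `x` in direction `h` is short for the Thompson metric. -/
lemma IsOrderUnitSpace.thompsonLE_add (hV : IsOrderUnitSpace V P v) {ε q : ℝ} {x h : V}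
    (hε : 0 < ε) (hx : x - ε • v ∈ P) (hq : 0 ≤ q) (hq' : q ≤ 1 / 2) (hh : ‖h‖ < ε * q) :
    ThompsonLE P v (4 * q) x (x + h) ∧ ThompsonLE P v (4 * q) (x + h) (x - h) := by
  have hxC : x ∈ openCone P v := ⟨ε, hε, hx⟩
  have hxP := hV.mem_of_mem_openCone hxC
  have h₁ := hV.smul_sub_mem_of_norm_lt_mul hx hq hh
  have h₂ : q • x - -h ∈ P :=
    hV.smul_sub_mem_of_norm_lt_mul hx hq (by rwa [norm_neg])
  have hadd : x + h ∈ openCone P v := by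
    refine hV.mem_openCone_of_smul_le one_half_pos hxC ?_
    convert hV.comb_mem (sub_nonneg.2 hq') zero_le_one hxP h₂ using 1
    module
  have hsub : x - h ∈ openCone P v := by
    refine hV.mem_openCone_of_smul_le one_half_pos hxC ?_
    convert hV.comb_mem (sub_nonneg.2 hq') zero_le_one hxP h₁ using 1
    module
  have hexp : 1 + 4 * q ≤ Real.exp (4 * q) := by linarith [Real.add_one_le_exp (4 * q)]
  have hq3 : 0 ≤ 3 * q - 4 * q ^ 2 := by nlinarith
  have hq2 : 0 ≤ 2 * q - 4 * q ^ 2 := by nlinarith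
  refine ⟨.of_le_exp hV (by positivity) hxC hadd hexp ?_ ?_,
    .of_le_exp hV (by positivity) hadd hsub hexp ?_ ?_⟩
  · convert hV.comb_mem (by positivity : 0 ≤ 1 + 4 * q) hq3 h₂ hxP using 1
    module
  · convert hV.comb_mem zero_le_one (by positivity : 0 ≤ 3 * q) h₁ hxP using 1
    module
  · convert hV.comb_mem (by positivity : 0 ≤ 2 + 4 * q) hq2 h₁ hxP using 1
    module
  · convert hV.comb_mem (by positivity : 0 ≤ 2 + 4 * q) hq2 h₂ hxP using 1
    module

/-- A gauge-reversing map is bounded on the region `ε • v ≤ x`. -/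
lemma GaugeReversing.exists_bound {Φ : V → W} (hV : IsOrderUnitSpace V P v)
    (hW : IsOrderUnitSpace W Q w) (hΦ : GaugeReversing P v Q w Φ) {ε : ℝ} (hε : 0 < ε) :
    ∃ N : ℝ, 0 ≤ N ∧ ∀ x, x - ε • v ∈ P → N • w - Φ x ∈ Q := by
  refine ⟨‖Φ (ε • v)‖ + 1, by positivity, fun x hx => ?_⟩
  have h₁ := (hΦ.2.2 _ (hV.smul_mem_openCone_s18 hε hV.unit_mem_openCone_s18) x ⟨ε, hε, hx⟩).1 hx
  have h₂ := hW.smul_sub_mem_of_norm_lt (lt_add_one ‖Φ (ε • v)‖)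
  convert hW.add_mem _ h₂ _ h₁ using 1
  abel

/-- Near each point of the open cone a gauge-reversing bijection is Lipschitz and has
quadratically small second differences. -/
lemma GaugeReversing.exists_second_difference_le {Φ : V → W} (hV : IsOrderUnitSpace V P v)
    (hW : IsOrderUnitSpace W Q w) (hΦ : GaugeReversing P v Q w Φ) {x₀ : V}
    (hx₀ : x₀ ∈ openCone P v) :
    ∃ δ K L : ℝ, 0 < δ ∧ 0 ≤ K ∧
      (∀ x ∈ Metric.ball x₀ δ, ∀ h : V, ‖h‖ ≤ δ → ‖Φ (x + h) - Φ x‖ ≤ L * ‖h‖) ∧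
      (∀ x ∈ Metric.ball x₀ δ, ∀ h : V, ‖h‖ ≤ δ →
        ‖Φ (x + h) + Φ (x - h) - (2 : ℝ) • Φ x‖ ≤ K * ‖h‖ ^ 2) := by
  obtain ⟨ε₀, hε₀, hx₀⟩ := hx₀
  set ε : ℝ := ε₀ / 2 with hεdef
  have hε : 0 < ε := half_pos hε₀
  obtain ⟨N, hN, hbd⟩ := hΦ.exists_bound hV hW hε
  have hnear : ∀ x ∈ Metric.ball x₀ (ε / 1024), x - ε • v ∈ P := by
    intro x hx
    rw [mem_ball_iff_norm'] at hx
    have := hV.smul_sub_mem_of_norm_lt (hx.trans_le (div_le_self hε.le (by norm_num)) : _ < ε)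
    convert hV.add_mem _ hx₀ _ this using 1
    rw [show ε₀ = 2 * ε by rw [hεdef]; ring]
    module
  have hq : ∀ h : V, h ≠ 0 → ‖h‖ ≤ ε / 1024 → 0 < 2 * ‖h‖ / ε ∧ 2 * ‖h‖ / ε ≤ 1 / 512 ∧
      ‖h‖ < ε * (2 * ‖h‖ / ε) := by
    intro h h0 hh
    have := norm_pos_iff.2 h0
    refine ⟨by positivity, ?_, ?_⟩
    · rw [div_le_iff₀ hε]; linarith
    · rw [mul_div_cancel₀ _ hε.ne']; linarith
  refine ⟨ε / 1024, 8 * 1536 * 64 / ε ^ 2 * N, 32 / ε * N, by positivity, by positivity, ?_, ?_⟩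
  · intro x hx h hh
    rcases eq_or_ne h 0 with rfl | h0
    · simp
    obtain ⟨q0, q1, q2⟩ := hq h h0 hh
    have hT := (hV.thompsonLE_add hε (hnear x hx) q0.le (by linarith) q2).1.map hV hΦ
    rw [norm_sub_rev]
    refine (hT.norm_sub_le hW (by linarith) hN (hbd x (hnear x hx))).trans_eq ?_
    field_simp
    ring
  · intro x hx h hh
    rcases eq_or_ne h 0 with rfl | h0
    · simp [two_smul]
    obtain ⟨q0, q1, q2⟩ := hq h h0 hh
    have hT := hΦ.map_midpoint hV hW (by positivity) (by linarith)
      (hV.thompsonLE_add hε (hnear x hx) q0.le (by linarith) q2).2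
    rw [show (1 / 2 : ℝ) • (x + h + (x - h)) = x by module] at hT
    have := hT.norm_sub_le hW (by nlinarith) hN (hbd x (hnear x hx))
    rw [show Φ (x + h) + Φ (x - h) - (2 : ℝ) • Φ x =
      (-2 : ℝ) • (Φ x - (1 / 2 : ℝ) • (Φ (x + h) + Φ (x - h))) by module, norm_smul]
    calc ‖(-2 : ℝ)‖ * _ ≤ ‖(-2 : ℝ)‖ * (4 * (1536 * (4 * (2 * ‖h‖ / ε)) ^ 2) * N) := by gcongr
      _ = _ := by
        rw [norm_neg, Real.norm_ofNat]
        field_simp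
        ring

end OrderUnitEstimates

/-- A gauge-reversing bijection `Φ` between the open cones of two
complete order unit spaces is continuously Fréchet differentiable: it is Fréchet
differentiable at every point of the open cone, and the derivative map is continuous
into the space of bounded operators with the operator norm. -/
theorem gaugeReversing_contDiff
    {V : Type*} [NormedAddCommGroup V] [NormedSpace ℝ V] [CompleteSpace V]
    {W : Type*} [NormedAddCommGroup W] [NormedSpace ℝ W] [CompleteSpace W]
    (P : Set V) (v : V) (Q : Set W) (w : W)
    (hV : IsOrderUnitSpace V P v) (hW : IsOrderUnitSpace W Q w)
    (Φ : V → W) (hΦ : GaugeReversing P v Q w Φ) :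
    ∃ D' : V → (V →L[ℝ] W),
      (∀ x ∈ openCone P v, HasFDerivAt Φ (D' x) x) ∧
      ContinuousOn D' (openCone P v) := by
  exact exists_continuousOn_fderiv fun _ hx => hΦ.exists_second_difference_le hV hW hx
end
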